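/- arXiv:2012.14004 — 2 statements merged into one kernel-verified Lean document; each statement's English description precedes it below -/
import Mathlib

section
/- Let P_m be a dyadic digital (t_m, m, s)-net in base 2. Then for all T ∈ Q^s(2^m) and Y ∈ [0,1)^s, the truncated discrepancy decomposes as D^{(m)}(P_m ⊕ T, Y) = ∑_{k=1}^m 𝔇_k(T,Y) + R(T,Y), where 𝔇_k(T,Y) = ∑_{A ∈ I_{m,s,k}} Ψ_A and R(T,Y) = ∑_{A ∈ I_{m,s,m+1}} Ψ_A, with Ψ_A = (−1)^{κ(A)} 2^{m−s−a_0(A)} r_A(Y) Λ_A(T ⊕ Y^{(m)}) and Λ_A(T ⊕ Y^{(m)}) = ∑_{𝔪 ∈ P_m^{⊥,*}, ρ(𝔪_i) ≤ a_i ∀i} e(∑_{i=1}^s (∑_{j=1}^m 𝔪_{i,j}(t_{i,j}+y_{i,j}) + 𝔪_{i,a_i})) (with the convention 𝔪_{i,0} := 0). -/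
open MeasureTheory Filter

noncomputable section

attribute [local instance] Classical.propDecidable

/-- The `a`-th binary digit (`a ≥ 1`) of the dyadic expansion of `x ∈ [0,1)`
(the finite expansion is used for dyadic rationals). -/
def bdigit (a : ℕ) (x : ℝ) : ℕ := (⌊x * 2 ^ a⌋).toNat % 2

/-- Digitwise addition modulo 2 of dyadic expansions: `x ⊕ y`. -/
def xorReal (x y : ℝ) : ℝ :=
  ∑' a : ℕ, (((bdigit (a + 1) x + bdigit (a + 1) y) % 2 : ℕ) : ℝ) / 2 ^ (a + 1)

/-- Coordinatewise digitwise addition `⊕` on vectors. -/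
def xorVec {s : ℕ} (X Y : Fin s → ℝ) : Fin s → ℝ := fun i => xorReal (X i) (Y i)

/-- Local discrepancy `D(P, Y)` of a finite point set `P` in `[0,1)^s`. -/
def Dloc {N s : ℕ} (P : Fin N → Fin s → ℝ) (Y : Fin s → ℝ) : ℝ :=
  (∑ n : Fin N, if ∀ i, 0 ≤ P n i ∧ P n i < Y i then (1 : ℝ) else 0) -
    (N : ℝ) * ∏ i, Y i

/-- `P` is a `(t,m,s)`-net in base 2: every elementary dyadic box of volume
`2^(t-m)` contains exactly `2^t` of the points. -/
def IsNet (t m s : ℕ) (P : Fin (2 ^ m) → Fin s → ℝ) : Prop :=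
  ∀ d a : Fin s → ℕ, (∀ i, a i < 2 ^ d i) → (∑ i, d i) + t = m →
    (Finset.univ.filter fun n => ∀ i,
        (a i : ℝ) / 2 ^ d i ≤ P n i ∧ P n i < ((a i : ℝ) + 1) / 2 ^ d i).card = 2 ^ t

/-- The digits `x_{n,i,j}` of the `n`-th point of the dyadic digital net with
generating matrices `C`. -/
def netDig (m s : ℕ) (C : Fin s → Matrix (Fin m) (Fin m) (ZMod 2)) (n : ℕ) :
    Fin s → Fin m → ZMod 2 :=
  fun i j => ∑ r : Fin m, C i j r * (if n.testBit r then 1 else 0)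

/-- The `n`-th point of the dyadic digital net with generating matrices `C`. -/
def netPoint (m s : ℕ) (C : Fin s → Matrix (Fin m) (Fin m) (ZMod 2)) (n : ℕ) :
    Fin s → ℝ :=
  fun i => ∑ j : Fin m, ((netDig m s C n i j).val : ℝ) / 2 ^ ((j : ℕ) + 1)

/-- The unit cube `[0,1]^s`. -/
def cube (s : ℕ) : Set (Fin s → ℝ) := Set.univ.pi fun _ => Set.Icc (0 : ℝ) 1

/-- The point of `Q^s(2^m)` with coordinates `T i / 2^m`. -/
def Qpt {s : ℕ} (m : ℕ) (T : Fin s → Fin (2 ^ m)) : Fin s → ℝ :=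
  fun i => ((T i : ℕ) : ℝ) / 2 ^ m

/-- `M_{s,p}(P) = (2^{-sm} ∑_{T ∈ Q^s(2^m)} ∫_{[0,1]^s} |D(P ⊕ T, Y)|^p dY)^{1/p}`. -/
def Msp (s m : ℕ) (p : ℝ) {N : ℕ} (P : Fin N → Fin s → ℝ) : ℝ :=
  ((2 : ℝ) ^ (-(s * m : ℤ)) * ∑ T : Fin s → Fin (2 ^ m),
      ∫ Y in cube s, |Dloc (fun n => xorVec (P n) (Qpt m T)) Y| ^ p) ^ (1 / p)

/-- The standard normal distribution function `Φ`. -/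
def PhiCDF (w : ℝ) : ℝ :=
  (Real.sqrt (2 * Real.pi))⁻¹ * ∫ u in Set.Iio w, Real.exp (-u ^ 2 / 2)

/-- `χ_p`, the `p`-th absolute moment of the standard Gaussian. -/
def chiMoment (p : ℝ) : ℝ :=
  (Real.sqrt (2 * Real.pi))⁻¹ * ∫ u : ℝ, |u| ^ p * Real.exp (-u ^ 2 / 2)

/-- Digits `y_{n,i,j}` of the points of the dyadic digital sequence generated by
the `ℕ × ℕ` matrices `C` over `F_2`. -/
def seqDig (s : ℕ) (C : Fin s → ℕ → ℕ → ZMod 2) (n : ℕ) : Fin s → ℕ → ZMod 2 :=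
  fun i j => ∑ r ∈ Finset.range (n + 1), C i j r * (if n.testBit r then 1 else 0)

/-- The `n`-th point of the dyadic digital sequence generated by `C`. -/
def seqPoint (s : ℕ) (C : Fin s → ℕ → ℕ → ZMod 2) (n : ℕ) : Fin s → ℝ :=
  fun i => ∑' j : ℕ, ((seqDig s C n i j).val : ℝ) / 2 ^ (j + 1)

/-- The digital sequence generated by `C` is a dyadic digital `(T,s)`-sequence:
for all `m ≥ 1` and `k ≥ 0` the block `X_{k2^m}, …, X_{k2^m+2^m-1}` is a
`(T(m),m,s)`-net in base 2. -/
def IsTSeq (s : ℕ) (Tf : ℕ → ℕ) (C : Fin s → ℕ → ℕ → ZMod 2) : Prop :=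
  (∀ m, Tf m ≤ m) ∧
  ∀ m, 1 ≤ m → ∀ k : ℕ,
    IsNet (Tf m) m s fun n : Fin (2 ^ m) => seqPoint s C (k * 2 ^ m + (n : ℕ))

/-- The dual net `P_m^⊥` of the digital net generated by `C`. -/
def dualNet (m s : ℕ) (C : Fin s → Matrix (Fin m) (Fin m) (ZMod 2)) :
    Finset (Fin s → Fin m → ZMod 2) :=
  Finset.univ.filter fun mm => ∀ n : Fin (2 ^ m),
    (∑ i, ∑ j, mm i j * netDig m s C (n : ℕ) i j) = 0

/-- `ρ(b)`: the position of the last nonzero digit (`ρ(0) = 0`). -/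
def rhoF {m : ℕ} (b : Fin m → ZMod 2) : ℕ :=
  (Finset.univ.filter fun j => b j ≠ 0).sup fun j => (j : ℕ) + 1

/-- The 1-indexed component `𝔪_{i,a}` (as `0` or `1`), with the convention
`𝔪_{i,0} = 0`. -/
def mAt {m : ℕ} (b : Fin m → ZMod 2) (a : ℕ) : ℕ :=
  if h : 1 ≤ a ∧ a ≤ m then (b ⟨a - 1, by omega⟩).val else 0

/-- The 1-indexed digit of a digit array, with the convention that digit `0`
and digits beyond `m` are `0`. -/
def dAt {m : ℕ} (y : Fin m → Fin 2) (a : ℕ) : ℕ :=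
  if h : 1 ≤ a ∧ a ≤ m then (y ⟨a - 1, by omega⟩).val else 0

/-- `κ(A)`: the number of nonzero entries of `A`. -/
def kapF {s : ℕ} (A : Fin s → ℕ) : ℕ := (Finset.univ.filter fun i => A i ≠ 0).card

/-- `a₀(A) = a₁ + ⋯ + a_s`. -/
def a0F {s : ℕ} (A : Fin s → ℕ) : ℕ := ∑ i, A i

/-- `Λ_A(T ⊕ Y^{(m)})` as a function of the digit arrays `t`, `y` of `T`, `Y`:
`∑_{𝔪 ∈ P^{⊥,*}, ρ(𝔪_i) ≤ a_i} e(∑_i (∑_j 𝔪_{i,j}(t_{i,j}+y_{i,j}) + 𝔪_{i,a_i}))`,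
where `e(n) = exp(πin) = (-1)^n`. -/
def LamF (m s : ℕ) (C : Fin s → Matrix (Fin m) (Fin m) (ZMod 2)) (A : Fin s → ℕ)
    (t y : Fin s → Fin m → Fin 2) : ℝ :=
  ∑ mm ∈ (dualNet m s C).filter fun mm => mm ≠ 0 ∧ ∀ i, rhoF (mm i) ≤ A i,
    (-1 : ℝ) ^
      (∑ i, ((∑ j, (mm i j).val * ((t i j : ℕ) + (y i j : ℕ))) + mAt (mm i) (A i)))

/-- The Rademacher function `r_A(Y)` as a function of the digit array of `Y`. -/
def rademF {m s : ℕ} (A : Fin s → ℕ) (y : Fin s → Fin m → Fin 2) : ℝ :=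
  ∏ i, (-1 : ℝ) ^ dAt (y i) (A i)

/-- `Ψ_A = (-1)^{κ(A)} 2^{m-s-a₀(A)} r_A(Y) Λ_A(T ⊕ Y^{(m)})` at digit level. -/
def PsiF (m s : ℕ) (C : Fin s → Matrix (Fin m) (Fin m) (ZMod 2)) (A : Fin s → ℕ)
    (t y : Fin s → Fin m → Fin 2) : ℝ :=
  (-1 : ℝ) ^ kapF A * (2 : ℝ) ^ ((m : ℤ) - (s : ℤ) - (a0F A : ℤ)) *
    rademF A y * LamF m s C A t y

/-- `V₀ = 10 log₂ m`. -/
def V0 (m : ℕ) : ℝ := 10 * Real.logb 2 m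

/-- `I_{m,s,k} = {A ∈ I_m^s : max_i a_i = k, a₀(A) ∈ (m - t_m, m + V₀)}`. -/
def IndexSet (m s tm k : ℕ) : Finset (Fin s → ℕ) :=
  (Fintype.piFinset fun _ : Fin s => Finset.range (m + 1)).filter fun A =>
    Finset.univ.sup A = k ∧ ((m : ℝ) - tm < a0F A ∧ (a0F A : ℝ) < m + V0 m)

/-- `I_{m,s,m+1} = {A ∈ I_m^s : a₀(A) ≥ m + V₀}`. -/
def IndexTail (m s : ℕ) : Finset (Fin s → ℕ) :=
  (Fintype.piFinset fun _ : Fin s => Finset.range (m + 1)).filter fun A =>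
    (m : ℝ) + V0 m ≤ (a0F A : ℝ)

/-- `𝔇_k(T,Y) = ∑_{A ∈ I_{m,s,k}} Ψ_A` at digit level. -/
def DDk (m s tm : ℕ) (C : Fin s → Matrix (Fin m) (Fin m) (ZMod 2)) (k : ℕ)
    (t y : Fin s → Fin m → Fin 2) : ℝ :=
  ∑ A ∈ IndexSet m s tm k, PsiF m s C A t y

/-- `R(T,Y) = ∑_{A ∈ I_{m,s,m+1}} Ψ_A` at digit level. -/
def Rtail (m s : ℕ) (C : Fin s → Matrix (Fin m) (Fin m) (ZMod 2))
    (t y : Fin s → Fin m → Fin 2) : ℝ :=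
  ∑ A ∈ IndexTail m s, PsiF m s C A t y

/-- `E^{(m)}_{Y,T}(f)`: the average of `f` over all digit arrays. -/
def Em (m s : ℕ) (f : (Fin s → Fin m → Fin 2) → (Fin s → Fin m → Fin 2) → ℝ) : ℝ :=
  (2 : ℝ) ^ (-(2 * s * m : ℤ)) *
    ∑ t : Fin s → Fin m → Fin 2, ∑ y : Fin s → Fin m → Fin 2, f t y

/-- Keep the first `k` digits of `t`, replace the remaining ones by those of `t'`. -/
def mergeDig {m s : ℕ} (k : ℕ) (t t' : Fin s → Fin m → Fin 2) :
    Fin s → Fin m → Fin 2 :=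
  fun i j => if (j : ℕ) < k then t i j else t' i j

/-- The conditional expectation `E^{(m)}_{Y,T}(f | F_k)` with respect to the
σ-field `F_k` generated by the dyadic cubes of side `2^{-k}`: the average of `f`
over the digits of index `> k`, as a function of the digit arrays `t`, `y`. -/
def EmCond (m s k : ℕ)
    (f : (Fin s → Fin m → Fin 2) → (Fin s → Fin m → Fin 2) → ℝ)
    (t y : Fin s → Fin m → Fin 2) : ℝ :=
  (2 : ℝ) ^ (-(2 * s * m : ℤ)) *
    ∑ t' : Fin s → Fin m → Fin 2, ∑ y' : Fin s → Fin m → Fin 2,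
      f (mergeDig k t t') (mergeDig k y y')

/-- `Θ_{A₁,A₂,k} = E^{(m)}_{Y,T}(Ψ_{A₁}Ψ_{A₂} | F_{k-1}) - E^{(m)}_{Y,T}(Ψ_{A₁}Ψ_{A₂})`. -/
def ThetaF (m s : ℕ) (C : Fin s → Matrix (Fin m) (Fin m) (ZMod 2))
    (A1 A2 : Fin s → ℕ) (k : ℕ) (t y : Fin s → Fin m → Fin 2) : ℝ :=
  EmCond m s (k - 1) (fun t' y' => PsiF m s C A1 t' y' * PsiF m s C A2 t' y') t y -
    Em m s fun t' y' => PsiF m s C A1 t' y' * PsiF m s C A2 t' y'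

/-- `Υ_{d₁,d₂,d₃,J,k}` for a partition `J = (J₁,J₂,J₃)` of `{1,…,s}` and
`k = (k₁,k₂)`. -/
def Ups (m s tm : ℕ) (C : Fin s → Matrix (Fin m) (Fin m) (ZMod 2))
    (J1 J2 J3 : Finset (Fin s)) (k1 k2 : ℕ) : ℝ :=
  ∑ A1 ∈ IndexSet m s tm k1, ∑ A2 ∈ IndexSet m s tm k1,
    ∑ A3 ∈ IndexSet m s tm k2, ∑ A4 ∈ IndexSet m s tm k2,
      (Em m s fun t y => ThetaF m s C A1 A2 k1 t y * ThetaF m s C A3 A4 k2 t y) *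
        (if (Finset.univ.filter fun i => A1 i = A2 i) = J1 ∧
            (Finset.univ.filter fun i => A1 i < A2 i) = J2 ∧
            (Finset.univ.filter fun i => A2 i < A1 i) = J3 ∧
            (Finset.univ.filter fun i => A3 i = A4 i) = J1 ∧
            (Finset.univ.filter fun i => A3 i < A4 i) = J2 ∧
            (Finset.univ.filter fun i => A4 i < A3 i) = J3 then (1 : ℝ) else 0)

/-- The array of the first `m` dyadic digits of the coordinates of `Y`. -/
def digitsOf (m s : ℕ) (Y : Fin s → ℝ) : Fin s → Fin m → Fin 2 :=
  fun i j => ⟨bdigit ((j : ℕ) + 1) (Y i), by unfold bdigit; omega⟩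

/-- Truncation `y^{(m)}` to the first `m` dyadic digits. -/
def truncR (m : ℕ) (y : ℝ) : ℝ :=
  ∑ j ∈ Finset.range m, (bdigit (j + 1) y : ℝ) / 2 ^ (j + 1)

/-- The elementary interval `Π_a` (`Π_0 = [0,1)`, `Π_a = [2^{-a}, 2^{1-a})`). -/
def PiBox (a : ℕ) : Set ℝ :=
  if a = 0 then Set.Ico 0 1 else Set.Ico ((2 : ℝ) ^ (-(a : ℤ))) ((2 : ℝ) ^ (1 - (a : ℤ)))

/-- `λ_A(Y) = 1_{Π_A}(Y) - vol(Π_A)`. -/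
def lamA {s : ℕ} (A : Fin s → ℕ) (Y : Fin s → ℝ) : ℝ :=
  (if ∀ i, Y i ∈ PiBox (A i) then (1 : ℝ) else 0) - (2 : ℝ) ^ (-(a0F A : ℤ))

/-- The micro-local discrepancy `λ_A(P_m^{(m)} ⊕ T ⊕ Y^{(m)})`. -/
def lamNet (m s : ℕ) (C : Fin s → Matrix (Fin m) (Fin m) (ZMod 2))
    (T Y : Fin s → ℝ) (A : Fin s → ℕ) : ℝ :=
  ∑ n : Fin (2 ^ m),
    lamA A fun i =>
      xorReal (xorReal (truncR m (netPoint m s C (n : ℕ) i)) (T i)) (truncR m (Y i))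

/-- The Rademacher function `r_A(Y)` for a real point `Y`. -/
def rademReal {s : ℕ} (A : Fin s → ℕ) (Y : Fin s → ℝ) : ℝ :=
  ∏ i, if A i = 0 then (1 : ℝ) else 1 - 2 * (bdigit (A i) (Y i) : ℝ)

/-- The truncated discrepancy
`D^{(m)}(P_m ⊕ T, Y) = 2^{-s} ∑_{A ∈ I_m^s} (-1)^{κ(A)} λ_A(P_m^{(m)} ⊕ T ⊕ Y^{(m)}) r_A(Y)`. -/
def Dm (m s : ℕ) (C : Fin s → Matrix (Fin m) (Fin m) (ZMod 2)) (T Y : Fin s → ℝ) : ℝ :=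
  (2 : ℝ) ^ (-(s : ℤ)) *
    ∑ A ∈ Fintype.piFinset fun _ : Fin s => Finset.range (m + 1),
      (-1 : ℝ) ^ kapF A * lamNet m s C T Y A * rademReal A Y

/-- `𝔼_{Y,T,m}(f) = 2^{-sm} ∑_{T ∈ Q^s(2^m)} ∫_{[0,1]^s} f(T,Y) dY`. -/
def EE (m s : ℕ) (f : (Fin s → ℝ) → (Fin s → ℝ) → ℝ) : ℝ :=
  (2 : ℝ) ^ (-(s * m : ℤ)) * ∑ T : Fin s → Fin (2 ^ m), ∫ Y in cube s, f (Qpt m T) Y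

/-- The integer formed by the first `a` binary digits `w 0, …, w (a - 1)`. -/
def leadingDigits (w : ℕ → ℕ) : ℕ → ℕ
  | 0 => 0
  | a + 1 => 2 * leadingDigits w a + w a

lemma leadingDigits_eq_zero_iff (w : ℕ → ℕ) (a : ℕ) :
    leadingDigits w a = 0 ↔ ∀ j < a, w j = 0 := by
  induction a with
  | zero => simp [leadingDigits]
  | succ a ih =>
    simp only [leadingDigits, Nat.add_eq_zero_iff, Nat.mul_eq_zero, ih, Nat.lt_succ_iff_lt_or_eq]
    constructor
    · rintro ⟨h1, h2⟩ j (hj | rfl)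
      · exact (h1.resolve_left (by norm_num)) j hj
      · exact h2
    · intro h
      exact ⟨Or.inr fun j hj => h j (Or.inl hj), h a (Or.inr rfl)⟩

lemma leadingDigits_bounds (w : ℕ → ℕ) (hw : ∀ j, w j ≤ 1) (a k : ℕ) :
    (leadingDigits w a : ℝ) ≤ (∑ j ∈ Finset.range (a + k), (w j : ℝ) / 2 ^ (j + 1)) * 2 ^ a ∧
    (∑ j ∈ Finset.range (a + k), (w j : ℝ) / 2 ^ (j + 1)) * 2 ^ a + 1 / 2 ^ k ≤
      (leadingDigits w a : ℝ) + 1 := by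
  induction k with
  | zero =>
    have : (∑ j ∈ Finset.range a, (w j : ℝ) / 2 ^ (j + 1)) * 2 ^ a = leadingDigits w a := by
      induction a with
      | zero => simp [leadingDigits]
      | succ a ih =>
        rw [Finset.sum_range_succ, add_mul, div_mul_cancel₀ _ (by positivity), pow_succ,
          ← mul_assoc, ih]
        simp only [leadingDigits]
        push_cast
        ring
    simp [this]
  | succ k ih =>
    have h1 : (w (a + k) : ℝ) ≤ 1 := by exact_mod_cast hw _
    have h0 : (0 : ℝ) ≤ w (a + k) := by positivity
    have e : (w (a + k) : ℝ) / 2 ^ (a + k + 1) * 2 ^ a = w (a + k) * (1 / 2 ^ (k + 1)) := by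
      field_simp
      ring
    have e2 : (1 : ℝ) / 2 ^ k = 2 * (1 / 2 ^ (k + 1)) := by
      field_simp
      ring
    have hp : (0 : ℝ) < 1 / 2 ^ (k + 1) := by positivity
    rw [← add_assoc, Finset.sum_range_succ, add_mul, e]
    constructor <;> nlinarith [ih.1, ih.2]

/-- The dyadic rational whose first `m` binary digits are `w` and whose other digits vanish. -/
def dyadicVal {m : ℕ} (w : Fin m → ZMod 2) : ℝ :=
  ∑ j : Fin m, ((w j).val : ℝ) / 2 ^ ((j : ℕ) + 1)

/-- Extension of a digit array by zeros. -/
def extDigits {m : ℕ} (w : Fin m → ZMod 2) (j : ℕ) : ℕ :=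
  if h : j < m then (w ⟨j, h⟩).val else 0

lemma extDigits_le_one {m : ℕ} (w : Fin m → ZMod 2) (j : ℕ) : extDigits w j ≤ 1 := by
  unfold extDigits
  split_ifs
  · exact Nat.le_of_lt_succ (ZMod.val_lt _)
  · exact zero_le_one

lemma dyadicVal_eq_sum_range {m n : ℕ} (h : m ≤ n) (w : Fin m → ZMod 2) :
    dyadicVal w = ∑ j ∈ Finset.range n, (extDigits w j : ℝ) / 2 ^ (j + 1) := by
  rw [← Finset.sum_subset (Finset.range_mono h), Finset.sum_range]
  · simp [dyadicVal, extDigits]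
  · intro j _ hj
    simp only [Finset.mem_range] at hj
    simp [extDigits, hj]

lemma floor_dyadicVal {m : ℕ} (w : Fin m → ZMod 2) (a : ℕ) :
    ⌊dyadicVal w * 2 ^ a⌋ = leadingDigits (extDigits w) a := by
  have h := leadingDigits_bounds (extDigits w) (extDigits_le_one w) a m
  rw [← dyadicVal_eq_sum_range (Nat.le_add_left m a)] at h
  have hp : (0 : ℝ) < 1 / 2 ^ m := by positivity
  rw [Int.floor_eq_iff]
  push_cast
  constructor <;> linarith [h.1, h.2]

lemma bdigit_dyadicVal {m : ℕ} (w : Fin m → ZMod 2) (a : ℕ) :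
    bdigit (a + 1) (dyadicVal w) = extDigits w a := by
  have := extDigits_le_one w a
  rw [bdigit, floor_dyadicVal, Int.toNat_natCast, leadingDigits]
  omega

lemma xorReal_dyadicVal {m : ℕ} (u v : Fin m → ZMod 2) :
    xorReal (dyadicVal u) (dyadicVal v) = dyadicVal (u + v) := by
  unfold xorReal
  simp only [bdigit_dyadicVal]
  rw [tsum_eq_sum (s := Finset.range m), Finset.sum_range, dyadicVal]
  · simp [extDigits, ZMod.val_add]
  · intro j hj
    simp only [Finset.mem_range] at hj
    simp [extDigits, hj]

lemma mem_PiBox_dyadicVal {m : ℕ} (w : Fin m → ZMod 2) {a : ℕ} (ha : a ≤ m) :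
    dyadicVal w ∈ PiBox a ↔
      ∀ j : Fin m, (j : ℕ) < a → w j = if (j : ℕ) + 1 = a then 1 else 0 := by
  rcases a with _ | a
  · have h := floor_dyadicVal w 0
    rw [Int.floor_eq_iff] at h
    simpa [PiBox, leadingDigits] using h
  · have h1 : dyadicVal w ∈ PiBox (a + 1) ↔ leadingDigits (extDigits w) (a + 1) = 1 := by
      have hf := floor_dyadicVal w (a + 1)
      have hp : (0 : ℝ) < 2 ^ (a + 1) := by positivity
      have e1 : (2 : ℝ) ^ (-((a + 1 : ℕ) : ℤ)) = 1 / 2 ^ (a + 1) := by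
        rw [zpow_neg, zpow_natCast, one_div]
      have e2 : (2 : ℝ) ^ (1 - ((a + 1 : ℕ) : ℤ)) = 2 / 2 ^ (a + 1) := by
        rw [zpow_sub₀ (by norm_num), zpow_natCast, zpow_one]
      rw [← Nat.cast_inj (R := ℤ), ← hf, Int.floor_eq_iff, PiBox, if_neg (Nat.succ_ne_zero a),
        Set.mem_Ico, e1, e2, div_le_iff₀ hp, lt_div_iff₀ hp]
      norm_num
    have h2 : leadingDigits (extDigits w) (a + 1) = 1 ↔
        leadingDigits (extDigits w) a = 0 ∧ extDigits w a = 1 := by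
      rw [leadingDigits]
      omega
    have hval : ∀ z : ZMod 2, z.val = 1 ↔ z = 1 := by decide
    rw [h1, h2, leadingDigits_eq_zero_iff]
    constructor
    · rintro ⟨h0, h3⟩ j hj
      split_ifs with hja
      · obtain rfl : (j : ℕ) = a := by omega
        simpa [extDigits, hval] using h3
      · simpa [extDigits] using h0 j (by omega)
    · intro h
      refine ⟨fun j hj => ?_, ?_⟩
      · have := h ⟨j, by omega⟩ (by simp; omega)
        rw [if_neg (by simp; omega)] at this
        simp [extDigits, this]
      · have := h ⟨a, by omega⟩ (by simp)
        simp only [if_true] at this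
        have ham : a < m := by omega
        simp [extDigits, this, ham, hval]

lemma truncR_eq_floor {y : ℝ} (hy : y ∈ Set.Ico (0 : ℝ) 1) (k : ℕ) :
    truncR k y = (⌊y * 2 ^ k⌋₊ : ℝ) / 2 ^ k := by
  induction k with
  | zero =>
    have : ⌊y⌋₊ = 0 := Nat.floor_eq_zero.2 hy.2
    simp [truncR, this]
  | succ k ih =>
    have h : ⌊y * 2 ^ (k + 1)⌋₊ / 2 = ⌊y * 2 ^ k⌋₊ := by
      rw [← Nat.floor_div_natCast]
      congr 1
      push_cast
      ring
    have h' : ⌊y * 2 ^ (k + 1)⌋₊ =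
        2 * ⌊y * 2 ^ k⌋₊ + bdigit (k + 1) y := by
      rw [bdigit, Int.floor_toNat]
      omega
    have hs : truncR (k + 1) y = truncR k y + (bdigit (k + 1) y : ℝ) / 2 ^ (k + 1) := by
      simp [truncR, Finset.sum_range_succ]
    rw [hs, ih, h']
    push_cast
    field_simp
    ring

/-- The first `m` binary digits of `y`, as elements of `F_2`. -/
def zdigits (m : ℕ) (y : ℝ) (j : Fin m) : ZMod 2 := (bdigit ((j : ℕ) + 1) y : ZMod 2)

lemma truncR_eq_dyadicVal (m : ℕ) (y : ℝ) : truncR m y = dyadicVal (zdigits m y) := by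
  rw [truncR, Finset.sum_range, dyadicVal]
  refine Finset.sum_congr rfl fun j _ => ?_
  rw [zdigits, ZMod.val_natCast, Nat.mod_eq_of_lt (a := bdigit _ y) (Nat.mod_lt _ two_pos)]

lemma eq_dyadicVal_zdigits {m c : ℕ} (hc : c < 2 ^ m) :
    (c : ℝ) / 2 ^ m = dyadicVal (zdigits m ((c : ℝ) / 2 ^ m)) := by
  rw [← truncR_eq_dyadicVal, truncR_eq_floor, div_mul_cancel₀ _ (by positivity),
    Nat.floor_natCast]
  refine ⟨by positivity, ?_⟩
  rw [div_lt_one (by positivity)]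
  exact_mod_cast hc

lemma truncR_dyadicVal {m : ℕ} (w : Fin m → ZMod 2) : truncR m (dyadicVal w) = dyadicVal w := by
  rw [truncR_eq_dyadicVal]
  congr 1
  ext j
  simp [zdigits, bdigit_dyadicVal, extDigits]

/-- The nontrivial additive character of `F_2`. -/
def signChar (z : ZMod 2) : ℝ := (-1) ^ z.val

@[simp] lemma signChar_zero : signChar 0 = 1 := by simp [signChar]

lemma signChar_one : signChar 1 = -1 := by simp [signChar, ZMod.val_one]

lemma zmod_two_cases (z : ZMod 2) : z = 0 ∨ z = 1 := by
  revert z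
  decide

lemma signChar_add (x y : ZMod 2) : signChar (x + y) = signChar x * signChar y := by
  have h2 : (1 + 1 : ZMod 2) = 0 := by decide
  rcases zmod_two_cases x with rfl | rfl <;> rcases zmod_two_cases y with rfl | rfl <;>
    simp [signChar_one, h2]

lemma signChar_sum {ι : Type*} (S : Finset ι) (f : ι → ZMod 2) :
    signChar (∑ i ∈ S, f i) = ∏ i ∈ S, signChar (f i) := by
  classical
  induction S using Finset.induction_on with
  | empty => simp
  | insert a S ha ih => rw [Finset.sum_insert ha, Finset.prod_insert ha, signChar_add, ih]

lemma signChar_natCast (n : ℕ) : signChar (n : ZMod 2) = (-1) ^ n := by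
  rw [signChar, ZMod.val_natCast, ← neg_one_pow_eq_pow_mod_two]

lemma rhoF_le_iff {m : ℕ} (b : Fin m → ZMod 2) (a : ℕ) :
    rhoF b ≤ a ↔ ∀ j : Fin m, a ≤ j → b j = 0 := by
  simp only [rhoF, Finset.sup_le_iff, Finset.mem_filter, Finset.mem_univ, true_and]
  refine forall_congr' fun j => ?_
  rw [← not_imp_not, not_le, not_not]
  exact imp_congr_left (by omega)

/-- The `a`-th unit digit array (zero if `a = 0`). -/
def unitDigit (m a : ℕ) (j : Fin m) : ZMod 2 := if (j : ℕ) + 1 = a then 1 else 0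

lemma mAt_cast {m : ℕ} (b : Fin m → ZMod 2) (a : ℕ) :
    (mAt b a : ZMod 2) = ∑ j, b j * unitDigit m a j := by
  unfold mAt unitDigit
  split_ifs with h
  · rw [Finset.sum_eq_single ⟨a - 1, by omega⟩]
    · rw [if_pos (by simp; omega)]
      simp
    · intro j _ hj
      rw [if_neg, mul_zero]
      intro h'
      exact hj (Fin.ext (by simp; omega))
    · simp
  · rw [Finset.sum_eq_zero]
    · simp
    · intro j _
      rw [if_neg (by omega), mul_zero]

/-- Walsh expansion of the indicator function of `Π_a`. -/
lemma indicator_eq_sum_signChar {m a : ℕ} (ha : a ≤ m) (w : Fin m → ZMod 2) :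
    (if dyadicVal w ∈ PiBox a then (1 : ℝ) else 0) =
      (1 / 2 ^ a) * ∑ b : Fin m → ZMod 2 with rhoF b ≤ a,
        signChar (∑ j, b j * w j + (mAt b a : ZMod 2)) := by
  have hS : (Finset.univ.filter fun b : Fin m → ZMod 2 => rhoF b ≤ a) =
      Fintype.piFinset fun j : Fin m => if (j : ℕ) < a then Finset.univ else {0} := by
    ext b
    simp only [Finset.mem_filter, Finset.mem_univ, true_and, rhoF_le_iff, Fintype.mem_piFinset]
    refine forall_congr' fun j => ?_
    split_ifs with h
    · simp [h]
    · simp [not_lt.1 h]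
  have hpos : ∀ x : ZMod 2, ∀ y : ZMod 2,
      ∑ b : ZMod 2, signChar (b * (x + y)) = 2 * if x = y then (1 : ℝ) else 0 := by
    intro x y
    have hu : (Finset.univ : Finset (ZMod 2)) = {0, 1} := by decide
    have h2 : (1 + 1 : ZMod 2) = 0 := by decide
    rw [hu, Finset.sum_pair (by decide)]
    rcases zmod_two_cases x with rfl | rfl <;> rcases zmod_two_cases y with rfl | rfl <;>
      simp [signChar_one, h2] <;> norm_num
  have key : (∑ b : Fin m → ZMod 2 with rhoF b ≤ a,
        signChar (∑ j, b j * w j + (mAt b a : ZMod 2))) =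
      ∏ j : Fin m, if (j : ℕ) < a then
        2 * (if w j = unitDigit m a j then (1 : ℝ) else 0) else 1 := by
    simp only [mAt_cast, ← Finset.sum_add_distrib, ← mul_add, signChar_sum]
    rw [hS, ← Finset.prod_univ_sum _ fun (j : Fin m) b => signChar (b * (w j + unitDigit m a j))]
    refine Finset.prod_congr rfl fun j _ => ?_
    split_ifs with h h'
    · rw [hpos, if_pos h']
    · rw [hpos, if_neg h']
    · simp
  rw [key, Finset.prod_ite, Finset.prod_const_one, mul_one, Finset.prod_mul_distrib,
    Finset.prod_const, Fin.card_filter_val_lt, min_eq_right ha, ← mul_assoc,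
    one_div_mul_cancel (by positivity), one_mul]
  by_cases h : dyadicVal w ∈ PiBox a
  · rw [if_pos h, Finset.prod_eq_one]
    intro j hj
    rw [if_pos]
    exact (mem_PiBox_dyadicVal w ha).1 h j (Finset.mem_filter.1 hj).2
  · rw [if_neg h]
    rw [mem_PiBox_dyadicVal w ha] at h
    push Not at h
    obtain ⟨j, hj, hne⟩ := h
    exact (Finset.prod_eq_zero (Finset.mem_filter.2 ⟨Finset.mem_univ j, hj⟩) (if_neg hne)).symm

lemma netDig_xor (m s : ℕ) (C : Fin s → Matrix (Fin m) (Fin m) (ZMod 2)) (n n' : ℕ)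
    (i : Fin s) (j : Fin m) :
    netDig m s C (n ^^^ n') i j = netDig m s C n i j + netDig m s C n' i j := by
  have h2 : (1 + 1 : ZMod 2) = 0 := by decide
  simp only [netDig, ← Finset.sum_add_distrib, ← mul_add]
  refine Finset.sum_congr rfl fun r _ => ?_
  rw [Nat.testBit_xor]
  cases n.testBit r <;> cases n'.testBit r <;> simp [h2]

/-- Orthogonality of characters on a digital net. -/
lemma sum_signChar_netDig (m s : ℕ) (C : Fin s → Matrix (Fin m) (Fin m) (ZMod 2))
    (mm : Fin s → Fin m → ZMod 2) :
    ∑ n : Fin (2 ^ m), signChar (∑ i, ∑ j, mm i j * netDig m s C (n : ℕ) i j) =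
      if mm ∈ dualNet m s C then (2 : ℝ) ^ m else 0 := by
  split_ifs with h
  · simp only [dualNet, Finset.mem_filter, Finset.mem_univ, true_and] at h
    simp [h]
  · simp only [dualNet, Finset.mem_filter, Finset.mem_univ, true_and, not_forall] at h
    obtain ⟨n0, h0⟩ := h
    have h1 := (zmod_two_cases _).resolve_left h0
    let f : Fin (2 ^ m) → Fin (2 ^ m) := fun n =>
      ⟨(n : ℕ) ^^^ (n0 : ℕ), Nat.xor_lt_two_pow n.2 n0.2⟩
    have hf : Function.Involutive f := fun n => Fin.ext (by simp [f])
    have hsum := Equiv.sum_comp hf.toPerm fun n : Fin (2 ^ m) =>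
      signChar (∑ i, ∑ j, mm i j * netDig m s C (n : ℕ) i j)
    have hneg : ∀ n : Fin (2 ^ m),
        signChar (∑ i, ∑ j, mm i j * netDig m s C ((f n : Fin (2 ^ m)) : ℕ) i j) =
          -signChar (∑ i, ∑ j, mm i j * netDig m s C (n : ℕ) i j) := by
      intro n
      have : (f n : ℕ) = (n : ℕ) ^^^ (n0 : ℕ) := rfl
      simp only [this, netDig_xor, mul_add, Finset.sum_add_distrib]
      rw [signChar_add, h1, signChar_one, mul_neg_one]
    simp only [Function.Involutive.coe_toPerm, hneg, Finset.sum_neg_distrib] at hsum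
    linarith

lemma bdigit_of_mem_Ico {x : ℝ} {a d j : ℕ} (hj : j ≤ d) (h1 : (a : ℝ) / 2 ^ d ≤ x)
    (h2 : x < ((a : ℝ) + 1) / 2 ^ d) : bdigit j x = a / 2 ^ (d - j) % 2 := by
  have hp : (0 : ℝ) < 2 ^ d := by positivity
  rw [div_le_iff₀ hp] at h1
  rw [lt_div_iff₀ hp] at h2
  have hx : ⌊x * 2 ^ d⌋₊ = a := by
    rw [Nat.floor_eq_iff ((Nat.cast_nonneg a).trans h1)]
    exact ⟨h1, h2⟩
  rw [bdigit, Int.floor_toNat, ← hx, ← Nat.floor_div_natCast]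
  congr 2
  obtain ⟨k, rfl⟩ := Nat.exists_eq_add_of_le hj
  rw [Nat.add_sub_cancel_left, pow_add]
  push_cast
  field_simp

/-- A nonzero dual vector of a `(t,m,s)`-net cannot be supported on boxes of order at most
`m - t`. -/
lemma dualNet_eq_zero {m s tm : ℕ} (C : Fin s → Matrix (Fin m) (Fin m) (ZMod 2))
    (hnet : IsNet tm m s fun n : Fin (2 ^ m) => netPoint m s C (n : ℕ)) (A : Fin s → ℕ)
    (hA : a0F A + tm ≤ m) {mm : Fin s → Fin m → ZMod 2} (hmm : mm ∈ dualNet m s C)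
    (hrho : ∀ i, rhoF (mm i) ≤ A i) : mm = 0 := by
  by_contra hne
  obtain ⟨i0, hi0⟩ := Function.ne_iff.1 hne
  obtain ⟨j0, hj0⟩ := Function.ne_iff.1 hi0
  simp only [Pi.zero_apply] at hj0
  let d : Fin s → ℕ := A + Pi.single i0 (m - tm - a0F A)
  have hdA : ∀ i, A i ≤ d i := fun i => by simp [d]
  have hd : ∑ i, d i + tm = m := by
    simp only [d, Pi.add_apply, Finset.sum_add_distrib, Finset.sum_pi_single', Finset.mem_univ,
      if_true]
    rw [a0F] at *
    omega
  have hsupp : ∀ i (j : Fin m), d i ≤ (j : ℕ) → mm i j = 0 := fun i j h =>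
    (rhoF_le_iff _ _).1 (hrho i) j ((hdA i).trans h)
  have hj0d : (j0 : ℕ) < d i0 := not_le.1 fun h => hj0 (hsupp i0 j0 h)
  let a : Fin s → ℕ := Pi.single i0 (2 ^ (d i0 - (j0 + 1)))
  have ha : ∀ i, a i < 2 ^ d i := by
    intro i
    by_cases h : i = i0
    · subst h
      simp only [a, Pi.single_eq_same]
      exact Nat.pow_lt_pow_right one_lt_two (by omega)
    · simp [a, h]
  have hcard := hnet d a ha hd
  obtain ⟨n, hn⟩ := Finset.card_pos.1 (hcard ▸ (by positivity : 0 < 2 ^ tm))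
  simp only [Finset.mem_filter, Finset.mem_univ, true_and] at hn
  have hdig : ∀ i (j : Fin m), (j : ℕ) < d i →
      (netDig m s C n i j).val = a i / 2 ^ (d i - (j + 1)) % 2 := by
    intro i j hj
    rw [← bdigit_of_mem_Ico (by omega) (hn i).1 (hn i).2]
    change _ = bdigit (j + 1) (dyadicVal (netDig m s C n i))
    rw [bdigit_dyadicVal]
    simp [extDigits]
  have hval : ∀ z : ZMod 2, z.val = 0 → z = 0 := by decide
  have hval1 : ∀ z : ZMod 2, z.val = 1 → z = 1 := by decide
  have hzero := (Finset.mem_filter.1 hmm).2 n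
  rw [Finset.sum_eq_single i0, Finset.sum_eq_single j0] at hzero
  · have h1 := hdig i0 j0 hj0d
    simp only [a, Pi.single_eq_same] at h1
    rw [Nat.div_self (by positivity)] at h1
    rw [hval1 _ h1, mul_one] at hzero
    exact hj0 hzero
  · intro j _ hj
    rcases le_or_gt (d i0) j with h | h
    · rw [hsupp i0 j h, zero_mul]
    · rw [hval (netDig m s C n i0 j), mul_zero]
      rw [hdig i0 j h]
      simp only [a, Pi.single_eq_same]
      have hjne : (j : ℕ) ≠ j0 := fun h => hj (Fin.ext h)
      have hbit : (2 ^ (d i0 - (j0 + 1))).testBit (d i0 - (j + 1)) = false := by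
        rw [Nat.testBit_two_pow]
        simp
        omega
      simpa [Nat.testBit_eq_decide_div_mod_eq] using hbit
  · simp
  · intro i _ hi
    refine Finset.sum_eq_zero fun j _ => ?_
    rcases le_or_gt (d i) j with h | h
    · rw [hsupp i j h, zero_mul]
    · rw [hval (netDig m s C n i j), mul_zero]
      rw [hdig i j h]
      simp [a, hi]
  · simp

lemma rademReal_eq_rademF {m s : ℕ} {A : Fin s → ℕ} (hA : ∀ i, A i ≤ m) (Y : Fin s → ℝ) :
    rademReal A Y = rademF A (digitsOf m s Y) := by
  refine Finset.prod_congr rfl fun i _ => ?_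
  split_ifs with h
  · simp [h, dAt]
  · have e : dAt (digitsOf m s Y i) (A i) = bdigit (A i) (Y i) := by
      have h1 : 1 ≤ A i := Nat.one_le_iff_ne_zero.2 h
      simp [dAt, h1, hA i, digitsOf, Nat.sub_add_cancel h1]
    rw [e]
    have : bdigit (A i) (Y i) = 0 ∨ bdigit (A i) (Y i) = 1 := Nat.mod_two_eq_zero_or_one _
    rcases this with h | h <;> rw [h] <;> norm_num

/-- The summands of `LamF` as character values. -/
lemma signChar_digitsOf {m s : ℕ} (A : Fin s → ℕ) (T Y : Fin s → ℝ)
    (mm : Fin s → Fin m → ZMod 2) :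
    (-1 : ℝ) ^ (∑ i, ((∑ j, (mm i j).val *
        ((digitsOf m s T i j : ℕ) + (digitsOf m s Y i j : ℕ))) + mAt (mm i) (A i))) =
      signChar (∑ i, (∑ j, mm i j * (zdigits m (T i) j + zdigits m (Y i) j) +
        (mAt (mm i) (A i) : ZMod 2))) := by
  rw [← signChar_natCast]
  push_cast
  simp only [ZMod.natCast_val, ZMod.cast_id', id_eq]
  rfl

/-- Walsh expansion of the discrepancy of a shifted digital net with respect to `Π_A`. -/
lemma lamNet_eq_LamF {m s : ℕ} (C : Fin s → Matrix (Fin m) (Fin m) (ZMod 2)) {T : Fin s → ℝ}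
    (hT : ∀ i, ∃ c : ℕ, c < 2 ^ m ∧ T i = (c : ℝ) / 2 ^ m) (Y : Fin s → ℝ)
    {A : Fin s → ℕ} (hA : ∀ i, A i ≤ m) :
    lamNet m s C T Y A =
      2 ^ m / 2 ^ a0F A * LamF m s C A (digitsOf m s T) (digitsOf m s Y) := by
  let g : (Fin s → Fin m → ZMod 2) → ZMod 2 := fun mm =>
    ∑ i, (∑ j, mm i j * (zdigits m (T i) j + zdigits m (Y i) j) + (mAt (mm i) (A i) : ZMod 2))
  let S : Finset (Fin s → Fin m → ZMod 2) := Finset.univ.filter fun mm => ∀ i, rhoF (mm i) ≤ A i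
  have hpoint : ∀ (n : ℕ) (i : Fin s),
      xorReal (xorReal (truncR m (netPoint m s C n i)) (T i)) (truncR m (Y i)) =
        dyadicVal (netDig m s C n i + zdigits m (T i) + zdigits m (Y i)) := by
    intro n i
    obtain ⟨c, hc, hTi⟩ := hT i
    have h1 : netPoint m s C n i = dyadicVal (netDig m s C n i) := rfl
    have h2 : T i = dyadicVal (zdigits m (T i)) := by
      rw [hTi]
      exact eq_dyadicVal_zdigits hc
    rw [h1, truncR_dyadicVal, truncR_eq_dyadicVal]
    conv_lhs => rw [h2]
    rw [xorReal_dyadicVal, xorReal_dyadicVal]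
  have hind : ∀ n : ℕ,
      (if ∀ i, xorReal (xorReal (truncR m (netPoint m s C n i)) (T i)) (truncR m (Y i)) ∈
          PiBox (A i) then (1 : ℝ) else 0) =
        1 / 2 ^ a0F A * ∑ mm ∈ S,
          signChar (∑ i, ∑ j, mm i j * netDig m s C n i j) * signChar (g mm) := by
    intro n
    have hS : S = Fintype.piFinset fun i => Finset.univ.filter fun b => rhoF b ≤ A i := by
      ext mm
      simp [S]
    have hprod : (if ∀ i, xorReal (xorReal (truncR m (netPoint m s C n i)) (T i))
        (truncR m (Y i)) ∈ PiBox (A i) then (1 : ℝ) else 0) =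
        ∏ i, if dyadicVal (netDig m s C n i + zdigits m (T i) + zdigits m (Y i)) ∈ PiBox (A i)
          then (1 : ℝ) else 0 := by
      simp only [hpoint]
      split_ifs with h
      · exact (Finset.prod_eq_one fun i _ => if_pos (h i)).symm
      · push Not at h
        obtain ⟨i, hi⟩ := h
        exact (Finset.prod_eq_zero (Finset.mem_univ i) (if_neg hi)).symm
    rw [hprod, Finset.prod_congr rfl fun i _ => indicator_eq_sum_signChar (hA i) _,
      Finset.prod_mul_distrib, Finset.prod_div_distrib, Finset.prod_const_one,
      Finset.prod_pow_eq_pow_sum, Finset.prod_univ_sum, hS]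
    refine congrArg₂ _ rfl (Finset.sum_congr rfl fun mm _ => ?_)
    rw [← signChar_sum, ← signChar_add]
    simp only [g, Finset.sum_add_distrib, Pi.add_apply, mul_add, add_assoc]
  have hdual : ∑ mm ∈ S, (if mm ∈ dualNet m s C then (2 : ℝ) ^ m else 0) * signChar (g mm) =
      2 ^ m * (1 + LamF m s C A (digitsOf m s T) (digitsOf m s Y)) := by
    have h0 : (0 : Fin s → Fin m → ZMod 2) ∈ S.filter fun mm => mm ∈ dualNet m s C := by
      simp [S, dualNet, rhoF_le_iff]
    have hg0 : g 0 = 0 := by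
      simp [g, mAt_cast]
    simp only [ite_mul, zero_mul]
    rw [← Finset.sum_filter, ← Finset.mul_sum, ← Finset.add_sum_erase _ _ h0, hg0, signChar_zero,
      LamF]
    refine congrArg _ (congrArg _ (Finset.sum_congr ?_ fun mm _ => ?_))
    · ext mm
      simp only [Finset.mem_erase, Finset.mem_filter, S, Finset.mem_univ, true_and]
      tauto
    · exact (signChar_digitsOf A T Y mm).symm
  simp only [lamNet, lamA, Finset.sum_sub_distrib, hind, ← Finset.mul_sum]
  rw [Finset.sum_comm]
  simp only [← Finset.sum_mul, sum_signChar_netDig, hdual]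
  rw [Finset.sum_const, Finset.card_univ, Fintype.card_fin, zpow_neg, zpow_natCast, nsmul_eq_mul]
  push_cast
  ring

lemma Dm_eq_sum_PsiF {m s : ℕ} (C : Fin s → Matrix (Fin m) (Fin m) (ZMod 2)) {T : Fin s → ℝ}
    (hT : ∀ i, ∃ c : ℕ, c < 2 ^ m ∧ T i = (c : ℝ) / 2 ^ m) (Y : Fin s → ℝ) :
    Dm m s C T Y = ∑ A ∈ Fintype.piFinset fun _ : Fin s => Finset.range (m + 1),
      PsiF m s C A (digitsOf m s T) (digitsOf m s Y) := by
  rw [Dm, Finset.mul_sum]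
  refine Finset.sum_congr rfl fun A hA => ?_
  have hA' : ∀ i, A i ≤ m := fun i =>
    Nat.lt_succ_iff.1 (Finset.mem_range.1 (Fintype.mem_piFinset.1 hA i))
  rw [lamNet_eq_LamF C hT Y hA', rademReal_eq_rademF hA', PsiF, zpow_sub₀ two_ne_zero,
    zpow_sub₀ two_ne_zero, zpow_neg, zpow_natCast, zpow_natCast, zpow_natCast]
  field_simp

lemma PsiF_eq_zero {m s tm : ℕ} (C : Fin s → Matrix (Fin m) (Fin m) (ZMod 2))
    (hnet : IsNet tm m s fun n : Fin (2 ^ m) => netPoint m s C (n : ℕ)) {A : Fin s → ℕ}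
    (hA : a0F A + tm ≤ m) (t y : Fin s → Fin m → Fin 2) : PsiF m s C A t y = 0 := by
  rw [PsiF, LamF, Finset.sum_eq_zero, mul_zero]
  intro mm hmm
  obtain ⟨hd, hne, hr⟩ := Finset.mem_filter.1 hmm
  exact absurd (dualNet_eq_zero C hnet A hA hd hr) hne

lemma PsiF_zero (m s : ℕ) (C : Fin s → Matrix (Fin m) (Fin m) (ZMod 2))
    (t y : Fin s → Fin m → Fin 2) : PsiF m s C 0 t y = 0 := by
  rw [PsiF, LamF, Finset.sum_eq_zero, mul_zero]
  intro mm hmm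
  obtain ⟨-, hne, hr⟩ := Finset.mem_filter.1 hmm
  refine absurd (funext fun i => funext fun j => ?_) hne
  exact (rhoF_le_iff _ _).1 (hr i) j (Nat.zero_le _)

/-- Lemma 1: decomposition of the truncated discrepancy,
`D^{(m)}(P_m ⊕ T, Y) = ∑_{k=1}^m 𝔇_k(T,Y) + R(T,Y)`. -/
theorem statement5 (s m tm : ℕ) (hs : 2 ≤ s)
    (C : Fin s → Matrix (Fin m) (Fin m) (ZMod 2))
    (hnet : IsNet tm m s fun n : Fin (2 ^ m) => netPoint m s C (n : ℕ))
    (T Y : Fin s → ℝ)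
    (hT : ∀ i, ∃ c : ℕ, c < 2 ^ m ∧ T i = (c : ℝ) / 2 ^ m)
    (hY : ∀ i, Y i ∈ Set.Ico (0 : ℝ) 1) :
    Dm m s C T Y =
      (∑ k ∈ Finset.Icc 1 m, DDk m s tm C k (digitsOf m s T) (digitsOf m s Y)) +
        Rtail m s C (digitsOf m s T) (digitsOf m s Y) := by
  rw [Dm_eq_sum_PsiF C hT Y,
    ← Finset.sum_filter_not_add_sum_filter _ fun A => (m : ℝ) + V0 m ≤ (a0F A : ℝ)]
  refine congrArg₂ _ ?_ rfl
  simp only [DDk]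
  rw [← Finset.sum_biUnion]
  · symm
    refine Finset.sum_subset ?_ ?_
    · intro A hA
      obtain ⟨k, -, hA⟩ := Finset.mem_biUnion.1 hA
      obtain ⟨h1, -, -, h2⟩ := Finset.mem_filter.1 hA
      exact Finset.mem_filter.2 ⟨h1, not_le.2 h2⟩
    · intro A hA hA'
      obtain ⟨h1, h2⟩ := Finset.mem_filter.1 hA
      by_cases h : a0F A + tm ≤ m
      · exact PsiF_eq_zero C hnet h _ _
      · have hsup : Finset.univ.sup A = 0 := by
          by_contra hne
          refine hA' (Finset.mem_biUnion.2 ⟨Finset.univ.sup A, Finset.mem_Icc.2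
            ⟨Nat.one_le_iff_ne_zero.2 hne, Finset.sup_le fun i _ => ?_⟩,
            Finset.mem_filter.2 ⟨h1, rfl, ?_, not_le.1 h2⟩⟩)
          · exact Nat.lt_succ_iff.1 (Finset.mem_range.1 (Fintype.mem_piFinset.1 h1 i))
          · rw [sub_lt_iff_lt_add]
            exact_mod_cast not_le.1 h
        have hzero : A = 0 := funext fun i =>
          Nat.le_zero.1 (hsup ▸ Finset.le_sup (Finset.mem_univ i))
        rw [hzero]
        exact PsiF_zero m s C _ _
  · intro k _ l _ hkl
    refine Finset.disjoint_left.2 fun A hk hl => hkl ?_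
    exact (Finset.mem_filter.1 hk).2.1.symm.trans (Finset.mem_filter.1 hl).2.1
end
end

section
/- Let s ≥ 2 and let P_m be a dyadic digital (t_m, m, s)-net in base 2 with t_m ≤ (1/10)·log₂ m. Then ∑_{k=1}^m E^{(m)}_{Y,T}(𝔇_k(T,Y)⁴) ≪ m^{2(s−1) − 2/5}, where the implied constant depends only on s. -/
open MeasureTheory Filter

noncomputable section

attribute [local instance] Classical.propDecidable

/-- A truncated binary expansion is at most `1 - 2^{-m}`. -/
lemma binary_sum_le (m : ℕ) (b : ℕ → ℕ) (hb : ∀ j, b j < 2) :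
    ∑ j ∈ Finset.range m, (b j : ℝ) / 2 ^ (j + 1) ≤ 1 - 1 / 2 ^ m := by
  induction m with
  | zero => simp
  | succ m ih =>
    rw [Finset.sum_range_succ]
    have h1 : (b m : ℝ) ≤ 1 := by exact_mod_cast Nat.lt_succ_iff.mp (hb m)
    have h2 : (b m : ℝ) / 2 ^ (m + 1) ≤ 1 / 2 ^ (m + 1) := by gcongr
    have h3 : (1 : ℝ) / 2 ^ m = 1 / 2 ^ (m + 1) + 1 / 2 ^ (m + 1) := by
      rw [pow_succ]; field_simp; norm_num
    linarith

lemma binary_sum_nonneg (m : ℕ) (b : ℕ → ℕ) :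
    0 ≤ ∑ j ∈ Finset.range m, (b j : ℝ) / 2 ^ (j + 1) :=
  Finset.sum_nonneg fun _ _ => by positivity

lemma binary_sum_succ (m : ℕ) (b : ℕ → ℕ) :
    ∑ j ∈ Finset.range (m + 1), (b j : ℝ) / 2 ^ (j + 1) =
      (∑ j ∈ Finset.range m, (b (j + 1) : ℝ) / 2 ^ (j + 1)) / 2 + (b 0 : ℝ) / 2 := by
  rw [Finset.sum_range_succ', Finset.sum_div]
  congr 1
  · refine Finset.sum_congr rfl fun j _ => ?_
    rw [pow_succ _ (j + 1)]; field_simp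
  · simp

/-- A number in a dyadic interval of length `2^{-D}` shares its first `D` digits with the
left end point. -/
lemma digits_eq_of_mem_dyadic (D : ℕ) : ∀ (m : ℕ) (b e : ℕ → ℕ), D ≤ m →
    (∀ j, b j < 2) → (∀ j, e j < 2) →
    ∑ j ∈ Finset.range D, (e j : ℝ) / 2 ^ (j + 1) ≤
      ∑ j ∈ Finset.range m, (b j : ℝ) / 2 ^ (j + 1) →
    ∑ j ∈ Finset.range m, (b j : ℝ) / 2 ^ (j + 1) <
      ∑ j ∈ Finset.range D, (e j : ℝ) / 2 ^ (j + 1) + 1 / 2 ^ D →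
    ∀ j < D, b j = e j := by
  induction D with
  | zero => intro m b e _ _ _ _ _ j hj; omega
  | succ D ih =>
    intro m b e hm hb he h1 h2
    obtain ⟨m, rfl⟩ : ∃ m', m = m' + 1 := ⟨m - 1, by omega⟩
    rw [binary_sum_succ, binary_sum_succ] at h1 h2
    have hb1 := binary_sum_le m (fun j => b (j + 1)) fun j => hb _
    have he1 := binary_sum_le D (fun j => e (j + 1)) fun j => he _
    have hb0 := binary_sum_nonneg m fun j => b (j + 1)
    have he0 := binary_sum_nonneg D fun j => e (j + 1)
    have hpm : (0 : ℝ) < 1 / 2 ^ m := by positivity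
    have hp : (1 : ℝ) / 2 ^ (D + 1) = 1 / 2 ^ D / 2 := by rw [pow_succ]; field_simp
    rw [hp] at h2
    have h0 : b 0 = e 0 := by
      have hb2 := hb 0
      have he2 := he 0
      interval_cases hx : b 0 <;> interval_cases hy : e 0 <;> first
        | rfl
        | (exfalso; simp only [Nat.cast_zero, Nat.cast_one] at h1 h2; linarith)
    rw [h0] at h1 h2
    intro j hj
    rcases j with _ | j
    · exact h0
    · exact ih m (fun j => b (j + 1)) (fun j => e (j + 1)) (by omega) (fun j => hb _)
        (fun j => he _) (by linarith) (by linarith) j (by omega)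

/-- The first `D i` digits of the points of a net take all values, where `∑ D i = m - t`. -/
lemma exists_netDig_eq {m s t : ℕ} {C : Fin s → Matrix (Fin m) (Fin m) (ZMod 2)}
    (hnet : IsNet t m s (fun n : Fin (2 ^ m) => netPoint m s C (n : ℕ)))
    (D : Fin s → ℕ) (hD : ∑ i, D i + t = m) (e : Fin s → Fin m → ZMod 2) :
    ∃ n : Fin (2 ^ m), ∀ i (j : Fin m), (j : ℕ) < D i → netDig m s C n i j = e i j := by
  have hDm : ∀ i, D i ≤ m := fun i => by
    have := Finset.single_le_sum (f := D) (fun i _ => Nat.zero_le _) (Finset.mem_univ i)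
    omega
  let ext : (Fin m → ZMod 2) → ℕ → ℕ := fun b j => if h : j < m then (b ⟨j, h⟩).val else 0
  have hext : ∀ b j, ext b j < 2 := by
    intro b j
    simp only [ext]
    split_ifs
    · exact ZMod.val_lt _
    · norm_num
  let a : Fin s → ℕ := fun i => ∑ j ∈ Finset.range (D i), ext (e i) j * 2 ^ (D i - 1 - j)
  have ha : ∀ i, (a i : ℝ) / 2 ^ D i =
      ∑ j ∈ Finset.range (D i), (ext (e i) j : ℝ) / 2 ^ (j + 1) := by
    intro i
    simp only [a]
    push_cast
    rw [Finset.sum_div]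
    refine Finset.sum_congr rfl fun j hj => ?_
    have hj := Finset.mem_range.mp hj
    rw [div_eq_div_iff (by positivity) (by positivity), mul_assoc, ← pow_add]
    congr 2
    omega
  have ha2 : ∀ i, a i < 2 ^ D i := by
    intro i
    have h1 := binary_sum_le (D i) (ext (e i)) (hext _)
    rw [← ha] at h1
    have h2 : (0 : ℝ) < 1 / 2 ^ D i := by positivity
    have h3 : (a i : ℝ) / 2 ^ D i < 1 := by linarith
    rw [div_lt_one (by positivity)] at h3
    exact_mod_cast h3
  have hcard := hnet D a ha2 hD
  obtain ⟨n, hn⟩ := Finset.card_pos.mp (hcard ▸ pow_pos (by norm_num : 0 < 2) t)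
  refine ⟨n, fun i j hj => ?_⟩
  have hni := (Finset.mem_filter.mp hn).2 i
  have hx : netPoint m s C n i =
      ∑ j ∈ Finset.range m, (ext (netDig m s C n i) j : ℝ) / 2 ^ (j + 1) := by
    rw [Finset.sum_range]
    simp [netPoint, ext]
  beta_reduce at hni
  rw [add_div, ha, hx] at hni
  have := digits_eq_of_mem_dyadic (D i) m _ _ (hDm i) (hext _) (hext _) hni.1 hni.2 j hj
  simp only [ext, j.2, dif_pos] at this
  exact ZMod.val_injective 2 this

/-- A dual vector whose components have `ρ(𝔪_i) ≤ D i`, `∑ D i = m - t`, vanishes. -/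
lemma eq_zero_of_mem_dualNet {m s t : ℕ} {C : Fin s → Matrix (Fin m) (Fin m) (ZMod 2)}
    (hnet : IsNet t m s (fun n : Fin (2 ^ m) => netPoint m s C (n : ℕ)))
    (D : Fin s → ℕ) (hD : ∑ i, D i + t = m) (b : Fin s → Fin m → ZMod 2)
    (hb : b ∈ dualNet m s C) (hbD : ∀ i (j : Fin m), D i ≤ j → b i j = 0) : b = 0 := by
  funext i₀ j₀
  by_contra hne
  obtain ⟨n, hn⟩ := exists_netDig_eq hnet D hD (Pi.single i₀ (Pi.single j₀ 1))
  have h0 := (Finset.mem_filter.mp hb).2 n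
  apply hne
  have h1 : ∀ i j, b i j * netDig m s C n i j =
      b i j * (Pi.single i₀ (Pi.single j₀ 1) : Fin s → Fin m → ZMod 2) i j := by
    intro i j
    rcases lt_or_ge (j : ℕ) (D i) with h | h
    · rw [hn i j h]
    · simp [hbD i j h]
  simp only [h1] at h0
  rw [Finset.sum_eq_single i₀] at h0
  · simpa [Pi.single_apply] using h0
  · intro i _ hi
    simp [hi]
  · simp

lemma exists_le_sum_eq {ι : Type*} [Fintype ι] (f : ι → ℕ) (n : ℕ) (hn : n ≤ ∑ i, f i) :
    ∃ g : ι → ℕ, (∀ i, g i ≤ f i) ∧ ∑ i, g i = n := by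
  induction n with
  | zero => exact ⟨0, by simp⟩
  | succ n ih =>
    obtain ⟨g, hg, hs⟩ := ih (by omega)
    obtain ⟨i, -, hi⟩ : ∃ i ∈ Finset.univ, g i < f i :=
      Finset.exists_lt_of_sum_lt (by omega)
    refine ⟨g + Pi.single i 1, fun j => ?_, ?_⟩
    · rcases eq_or_ne j i with rfl | h
      · simpa using hi
      · simpa [h] using hg j
    · simp [Finset.sum_add_distrib, hs]

lemma eq_zero_of_rhoF_le {m : ℕ} {b : Fin m → ZMod 2} {a : ℕ} (h : rhoF b ≤ a) (j : Fin m)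
    (hj : a ≤ j) : b j = 0 := by
  by_contra hne
  have : (j : ℕ) + 1 ≤ rhoF b :=
    Finset.le_sup (f := fun j : Fin m => (j : ℕ) + 1) (by simp [hne])
  omega

/-- The dual space of a net has at most `2^{a₀(A) - m + t}` elements with `ρ(𝔪_i) ≤ a_i`. -/
lemma card_dualNet_filter_le {m s t : ℕ} {C : Fin s → Matrix (Fin m) (Fin m) (ZMod 2)}
    (hnet : IsNet t m s (fun n : Fin (2 ^ m) => netPoint m s C (n : ℕ)))
    (htm : t ≤ m) (A : Fin s → ℕ) (hA : ∀ i, A i ≤ m) (hAm : m ≤ a0F A + t) :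
    ((dualNet m s C).filter fun b => ∀ i, rhoF (b i) ≤ A i).card ≤ 2 ^ (a0F A + t - m) := by
  obtain ⟨D, hDA, hD⟩ := exists_le_sum_eq A (m - t) (by unfold a0F at hAm; omega)
  let φ : (Fin s → Fin m → ZMod 2) → ((i : Fin s) → Fin (A i - D i) → ZMod 2) :=
    fun b i l => b i ⟨D i + l, by have := hA i; have := l.2; omega⟩
  have hinj : Set.InjOn φ ((dualNet m s C).filter fun b => ∀ i, rhoF (b i) ≤ A i) := by
    intro b hb b' hb' hφ
    rw [Finset.mem_coe, Finset.mem_filter] at hb hb'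
    rw [← sub_eq_zero]
    refine eq_zero_of_mem_dualNet hnet D (by omega) _ ?_ ?_
    · have h1 := (Finset.mem_filter.mp hb.1).2
      have h2 := (Finset.mem_filter.mp hb'.1).2
      refine Finset.mem_filter.mpr ⟨Finset.mem_univ _, fun n => ?_⟩
      simp only [Pi.sub_apply, sub_mul, Finset.sum_sub_distrib, h1 n, h2 n, sub_zero]
    · intro i j hj
      rcases lt_or_ge (j : ℕ) (A i) with h | h
      · have := congrFun (congrFun hφ i) ⟨j - D i, by omega⟩
        simp only [φ, Nat.add_sub_cancel' hj] at this
        simpa [sub_eq_zero] using this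
      · simp [eq_zero_of_rhoF_le (hb.2 i) j h, eq_zero_of_rhoF_le (hb'.2 i) j h]
  have := Finset.card_le_card_of_injOn (t := Finset.univ) φ
    (fun _ _ => Finset.mem_coe.mpr (Finset.mem_univ _)) hinj
  refine this.trans (le_of_eq ?_)
  have hsub : ∑ i, (A i - D i) = a0F A + t - m := by
    have : ∑ i, (A i - D i) + ∑ i, D i = ∑ i, A i := by
      rw [← Finset.sum_add_distrib]
      exact Finset.sum_congr rfl fun i _ => Nat.sub_add_cancel (hDA i)
    unfold a0F
    omega
  simp [Finset.card_univ, Fintype.card_pi, ZMod.card, Finset.prod_pow_eq_pow_sum, hsub]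

lemma abs_PsiF_le {m s t : ℕ} {C : Fin s → Matrix (Fin m) (Fin m) (ZMod 2)}
    (hnet : IsNet t m s (fun n : Fin (2 ^ m) => netPoint m s C (n : ℕ)))
    (htm : t ≤ m) (A : Fin s → ℕ) (hA : ∀ i, A i ≤ m) (hAm : m ≤ a0F A + t)
    (x y : Fin s → Fin m → Fin 2) : |PsiF m s C A x y| ≤ 2 ^ t := by
  have h1 : |LamF m s C A x y| ≤ 2 ^ (a0F A + t - m) := by
    unfold LamF
    refine (Finset.abs_sum_le_sum_abs _ _).trans ?_
    simp only [abs_pow, abs_neg, abs_one, one_pow, Finset.sum_const, nsmul_eq_mul, mul_one]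
    refine le_trans ?_ (Nat.cast_le.mpr (card_dualNet_filter_le hnet htm A hA hAm)) |>.trans
      (by push_cast; exact le_rfl)
    exact Nat.cast_le.mpr (Finset.card_le_card fun b hb => by
      simp only [Finset.mem_filter] at hb ⊢
      exact ⟨hb.1, hb.2.2⟩)
  have h2 : |rademF A y| = 1 := by simp [rademF, Finset.abs_prod]
  unfold PsiF
  rw [abs_mul, abs_mul, abs_mul, h2, abs_pow, abs_neg, abs_one, one_pow, one_mul, mul_one,
    abs_of_pos (by positivity : (0 : ℝ) < 2 ^ ((m : ℤ) - (s : ℤ) - (a0F A : ℤ)))]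
  calc (2 : ℝ) ^ ((m : ℤ) - (s : ℤ) - (a0F A : ℤ)) * |LamF m s C A x y|
      ≤ (2 : ℝ) ^ ((m : ℤ) - (s : ℤ) - (a0F A : ℤ)) * 2 ^ (a0F A + t - m) := by gcongr
    _ = (2 : ℝ) ^ ((t : ℤ) - s) := by
        rw [← zpow_natCast, ← zpow_add₀ (by norm_num)]
        congr 1
        push_cast [Nat.cast_sub hAm]
        ring
    _ ≤ (2 : ℝ) ^ (t : ℤ) := zpow_le_zpow_right₀ (by norm_num) (by omega)
    _ = 2 ^ t := zpow_natCast _ _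

/-- The digit array with a single `1`, in position `(i, j)`. -/
def unitDig {m s : ℕ} (i : Fin s) (j : Fin m) : Fin s → Fin m → Fin 2 :=
  Pi.single i (Pi.single j 1)

lemma LamF_add_add {m s : ℕ} (C : Fin s → Matrix (Fin m) (Fin m) (ZMod 2)) (A : Fin s → ℕ)
    (x y e : Fin s → Fin m → Fin 2) : LamF m s C A (x + e) (y + e) = LamF m s C A x y := by
  have key : ∀ a b c : Fin 2,
      (((a + c : Fin 2) : ℕ) + ((b + c : Fin 2) : ℕ)) % 2 = ((a : ℕ) + (b : ℕ)) % 2 := by decide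
  unfold LamF
  refine Finset.sum_congr rfl fun b _ => ?_
  have hmod : ∀ i, (∑ j, (b i j).val * (((x + e) i j : ℕ) + ((y + e) i j : ℕ))) ≡
      (∑ j, (b i j).val * ((x i j : ℕ) + (y i j : ℕ))) [MOD 2] := by
    intro i
    refine Nat.ModEq.sum fun j _ => Nat.ModEq.mul_left _ (key _ _ _)
  have : (∑ i, ((∑ j, (b i j).val * (((x + e) i j : ℕ) + ((y + e) i j : ℕ))) +
      mAt (b i) (A i))) ≡ (∑ i, ((∑ j, (b i j).val * ((x i j : ℕ) + (y i j : ℕ))) +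
      mAt (b i) (A i))) [MOD 2] :=
    Nat.ModEq.sum fun i _ => Nat.ModEq.add_right _ (hmod i)
  rw [neg_one_pow_eq_pow_mod_two, this, ← neg_one_pow_eq_pow_mod_two]

lemma rademF_add_unitDig {m s : ℕ} (A : Fin s → ℕ) (y : Fin s → Fin m → Fin 2) (i : Fin s)
    (j : Fin m) :
    rademF A (y + unitDig i j) = (if A i = j + 1 then -1 else 1) * rademF A y := by
  have key : ∀ a : Fin 2, (-1 : ℝ) ^ ((a + 1 : Fin 2) : ℕ) = -(-1) ^ (a : ℕ) := by
    intro a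
    have h : (a = 0 ∧ ((a + 1 : Fin 2) : ℕ) = 1) ∨ (a = 1 ∧ ((a + 1 : Fin 2) : ℕ) = 0) := by
      revert a
      decide
    rcases h with ⟨h, h'⟩ | ⟨h, h'⟩ <;> rw [h', h] <;> norm_num
  unfold rademF
  rw [← Finset.mul_prod_erase _ _ (Finset.mem_univ i),
    ← Finset.mul_prod_erase _ (fun i => (-1 : ℝ) ^ dAt (y i) (A i)) (Finset.mem_univ i),
    ← mul_assoc]
  congr 1
  · by_cases h : A i = j + 1
    · have hj : 1 ≤ (j : ℕ) + 1 ∧ (j : ℕ) + 1 ≤ m := ⟨by omega, j.2⟩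
      simp [h, dAt, hj, unitDig, key]
    · rw [if_neg h, one_mul]
      congr 1
      unfold dAt
      split_ifs with h'
      · have : (⟨A i - 1, by omega⟩ : Fin m) ≠ j := by
          intro he
          have := congrArg Fin.val he
          simp only at this
          omega
        simp [unitDig, this]
      · rfl
  · refine Finset.prod_congr rfl fun l hl => ?_
    have hl := Finset.ne_of_mem_erase hl
    simp [unitDig, hl]

lemma PsiF_add_unitDig {m s : ℕ} (C : Fin s → Matrix (Fin m) (Fin m) (ZMod 2)) (A : Fin s → ℕ)
    (x y : Fin s → Fin m → Fin 2) (i : Fin s) (j : Fin m) :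
    PsiF m s C A (x + unitDig i j) (y + unitDig i j) =
      (if A i = j + 1 then -1 else 1) * PsiF m s C A x y := by
  unfold PsiF
  rw [LamF_add_add, rademF_add_unitDig]
  ring

/-- The numbers `a, b, c, d` can be grouped into two pairs of equal numbers. -/
def PairsUp (a b c d : ℕ) : Prop := (a = b ∧ c = d) ∨ (a = c ∧ b = d) ∨ (a = d ∧ b = c)

lemma exists_odd_of_not_pairsUp {a b c d : ℕ} (h : ¬ PairsUp a b c d) :
    ∃ x, 1 ≤ x ∧ (x = a ∨ x = b ∨ x = c ∨ x = d) ∧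
      (if a = x then -1 else 1) * (if b = x then -1 else 1) * (if c = x then -1 else 1) *
        (if d = x then -1 else 1) = (-1 : ℝ) := by
  unfold PairsUp at h
  by_contra! hc
  have ha := hc a
  have hb := hc b
  have hcc := hc c
  have hd := hc d
  simp only [true_or, or_true, forall_const, if_true] at ha hb hcc hd
  apply h
  rcases Nat.eq_zero_or_pos a with h0 | h0 <;> rcases Nat.eq_zero_or_pos b with h1 | h1 <;>
  rcases Nat.eq_zero_or_pos c with h2 | h2 <;> rcases Nat.eq_zero_or_pos d with h3 | h3 <;>
  grind

lemma Em_PsiF_mul_eq_zero {m s : ℕ} (C : Fin s → Matrix (Fin m) (Fin m) (ZMod 2))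
    (A₁ A₂ A₃ A₄ : Fin s → ℕ) (h₁ : ∀ i, A₁ i ≤ m) (h₂ : ∀ i, A₂ i ≤ m) (h₃ : ∀ i, A₃ i ≤ m)
    (h₄ : ∀ i, A₄ i ≤ m) (h : ¬ ∀ i, PairsUp (A₁ i) (A₂ i) (A₃ i) (A₄ i)) :
    (Em m s fun x y => PsiF m s C A₁ x y * PsiF m s C A₂ x y * PsiF m s C A₃ x y *
      PsiF m s C A₄ x y) = 0 := by
  push Not at h
  obtain ⟨i, hi⟩ := h
  obtain ⟨a, ha1, ham, ha⟩ := exists_odd_of_not_pairsUp hi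
  obtain ⟨j, rfl⟩ : ∃ j : Fin m, a = j + 1 := by
    have := h₁ i; have := h₂ i; have := h₃ i; have := h₄ i
    exact ⟨⟨a - 1, by omega⟩, by simp only; omega⟩
  unfold Em
  refine mul_eq_zero_of_right _ ?_
  set S := ∑ x : Fin s → Fin m → Fin 2, ∑ y : Fin s → Fin m → Fin 2,
    PsiF m s C A₁ x y * PsiF m s C A₂ x y * PsiF m s C A₃ x y * PsiF m s C A₄ x y with hS
  have : S = -S := by
    conv_lhs => rw [hS, ← Equiv.sum_comp (Equiv.addRight (unitDig i j))]
    rw [hS, ← Finset.sum_neg_distrib]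
    refine Finset.sum_congr rfl fun x _ => ?_
    rw [← Equiv.sum_comp (Equiv.addRight (unitDig i j)), ← Finset.sum_neg_distrib]
    refine Finset.sum_congr rfl fun y _ => ?_
    simp only [Equiv.coe_addRight, PsiF_add_unitDig]
    linear_combination (PsiF m s C A₁ x y * PsiF m s C A₂ x y * PsiF m s C A₃ x y *
      PsiF m s C A₄ x y) * ha
  linarith

/-- If the members of a set of functions `Fin s → {0, …, m}` are determined by their values off
`J`, then the set has at most `(m + 1)^(s - |J|)` elements. -/
lemma card_le_of_determined {s m : ℕ} (S : Finset (Fin s → ℕ)) (hS : ∀ u ∈ S, ∀ i, u i ≤ m)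
    (J : Finset (Fin s))
    (hdet : ∀ u ∈ S, ∀ v ∈ S, (∀ l ∉ J, u l = v l) → u = v) :
    S.card ≤ (m + 1) ^ (s - J.card) := by
  have hinj : Set.InjOn (fun (u : Fin s → ℕ) (l : {l // l ∉ J}) => (Fin.ofNat (m + 1) (u l))) S := by
    intro u hu v hv huv
    refine hdet u hu v hv fun l hl => ?_
    have h := congrArg Fin.val (congrFun huv ⟨l, hl⟩)
    have h1 := hS u hu l
    have h2 := hS v hv l
    simp only [Fin.ofNat] at h
    rwa [Nat.mod_eq_of_lt (by omega), Nat.mod_eq_of_lt (by omega)] at h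
  have := Finset.card_le_card_of_injOn (t := Finset.univ) _
    (fun _ _ => Finset.mem_coe.mpr (Finset.mem_univ _)) hinj
  refine this.trans (le_of_eq ?_)
  simp [Finset.card_univ, Fintype.card_subtype_compl]

/-- The vectors in `{0, …, m}^s` with coordinate sum `c`. -/
def sumBox (s m c : ℕ) : Finset (Fin s → ℕ) :=
  (Fintype.piFinset fun _ : Fin s => Finset.range (m + 1)).filter fun u => ∑ i, u i = c

lemma mem_sumBox {s m c : ℕ} {u : Fin s → ℕ} :
    u ∈ sumBox s m c ↔ (∀ i, u i ≤ m) ∧ ∑ i, u i = c := by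
  simp [sumBox, Fintype.mem_piFinset]

lemma card_sumBox_le {s m c : ℕ} (hs : 2 ≤ s) : (sumBox s m c).card ≤ (m + 1) ^ (s - 1) := by
  let i : Fin s := ⟨0, by omega⟩
  have := card_le_of_determined (sumBox s m c) (fun u hu => (mem_sumBox.mp hu).1) {i} ?_
  · simpa using this
  · intro u hu v hv huv
    have h1 := (mem_sumBox.mp hu).2
    have h2 := (mem_sumBox.mp hv).2
    rw [← Finset.add_sum_erase _ _ (Finset.mem_univ i)] at h1 h2
    have h3 : ∑ l ∈ Finset.univ.erase i, u l = ∑ l ∈ Finset.univ.erase i, v l :=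
      Finset.sum_congr rfl fun l hl => huv l (by simpa using Finset.ne_of_mem_erase hl)
    funext l
    by_cases hl : l = i
    · subst hl; omega
    · exact huv l (by simpa using hl)

lemma sum_erase_erase {s : ℕ} (u : Fin s → ℕ) {i j : Fin s} (hij : i ≠ j) :
    ∑ l, u l = u i + (u j + ∑ l ∈ (Finset.univ.erase i).erase j, u l) := by
  rw [Finset.add_sum_erase _ _ (by simp [hij.symm]), Finset.add_sum_erase _ _ (Finset.mem_univ i)]

lemma eq_of_eq_off_pair {s c : ℕ} {u v : Fin s → ℕ} {i j : Fin s} (hij : i ≠ j)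
    (hu : ∑ l, u l = c) (hv : ∑ l, v l = c) (huv : ∀ l ∉ ({i, j} : Finset (Fin s)), u l = v l)
    (h : u i + u j = v i + v j → u i = v i) : u = v := by
  rw [sum_erase_erase _ hij] at hu hv
  have h3 : ∑ l ∈ (Finset.univ.erase i).erase j, u l =
      ∑ l ∈ (Finset.univ.erase i).erase j, v l :=
    Finset.sum_congr rfl fun l hl => huv l (by simp at hl; simp [hl])
  have h4 := h (by omega)
  funext l
  by_cases hl : l = i
  · exact hl ▸ h4
  by_cases hl' : l = j
  · subst hl'; omega
  · exact huv l (by simp [hl, hl'])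

lemma card_sumBox_filter_value_le {s m c x : ℕ} (hs : 2 ≤ s) (j : Fin s) :
    ((sumBox s m c).filter fun u => u j = x).card ≤ (m + 1) ^ (s - 2) := by
  have : Nontrivial (Fin s) := Fin.nontrivial_iff_two_le.mpr hs
  obtain ⟨i, hi⟩ := exists_ne j
  have := card_le_of_determined ((sumBox s m c).filter fun u => u j = x)
    (fun u hu => (mem_sumBox.mp (Finset.mem_filter.mp hu).1).1) {j, i} ?_
  · rwa [Finset.card_pair hi.symm] at this
  · intro u hu v hv huv
    rw [Finset.mem_filter, mem_sumBox] at hu hv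
    exact eq_of_eq_off_pair hi.symm hu.1.2 hv.1.2 huv (by omega)

lemma card_sumBox_filter_eq_le {s m c : ℕ} {i j : Fin s} (hij : i ≠ j) :
    ((sumBox s m c).filter fun u => u i = u j).card ≤ (m + 1) ^ (s - 2) := by
  have := card_le_of_determined ((sumBox s m c).filter fun u => u i = u j)
    (fun u hu => (mem_sumBox.mp (Finset.mem_filter.mp hu).1).1) {i, j} ?_
  · rwa [Finset.card_pair hij] at this
  · intro u hu v hv huv
    rw [Finset.mem_filter, mem_sumBox] at hu hv
    exact eq_of_eq_off_pair hij hu.1.2 hv.1.2 huv (by omega)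

/-- The pair `(u, v)` has a coincidence `u i = v j`, or `u i = u j` for some `i ≠ j`. -/
def Coincide {s : ℕ} (w : (Fin s → ℕ) × (Fin s → ℕ)) : Prop :=
  (∃ i j, w.1 i = w.2 j) ∨ ∃ i j, i ≠ j ∧ w.1 i = w.1 j

lemma card_coincide_le {s m c d : ℕ} (hs : 2 ≤ s) :
    ((sumBox s m c ×ˢ sumBox s m d).filter Coincide).card ≤
      2 * s ^ 2 * (m + 1) ^ (2 * s - 3) := by
  let F : Fin s × Fin s → Finset ((Fin s → ℕ) × (Fin s → ℕ)) := fun p =>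
    (sumBox s m c ×ˢ sumBox s m d).filter fun w => w.1 p.1 = w.2 p.2
  let G : Fin s × Fin s → Finset ((Fin s → ℕ) × (Fin s → ℕ)) := fun p =>
    (sumBox s m c ×ˢ sumBox s m d).filter fun w => p.1 ≠ p.2 ∧ w.1 p.1 = w.1 p.2
  have hpow : (m + 1) ^ (s - 1) * (m + 1) ^ (s - 2) = (m + 1) ^ (2 * s - 3) := by
    rw [← pow_add]
    congr 1
    omega
  have hF : ∀ p, (F p).card ≤ (m + 1) ^ (2 * s - 3) := by
    intro p
    have h := Finset.card_eq_sum_card_fiberwise (f := Prod.fst) (s := F p) (t := sumBox s m c)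
      fun w hw => by
        simp only [F, Finset.mem_coe, Finset.mem_filter, Finset.mem_product] at hw
        exact hw.1.1
    rw [h, ← hpow]
    refine (Finset.sum_le_card_nsmul _ _ ((m + 1) ^ (s - 2)) fun u _ => ?_).trans ?_
    · refine le_trans (Finset.card_le_card_of_injOn Prod.snd (fun w hw => ?_) ?_)
        (card_sumBox_filter_value_le (m := m) (c := d) (x := u p.1) hs p.2)
      · simp only [F, Finset.mem_coe, Finset.mem_filter, Finset.mem_product] at hw ⊢
        exact ⟨hw.1.1.2, by rw [← hw.1.2, hw.2]⟩
      · intro w hw w' hw' hww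
        simp only [Finset.mem_coe, Finset.mem_filter] at hw hw'
        exact Prod.ext (hw.2.trans hw'.2.symm) hww
    · rw [smul_eq_mul]
      exact Nat.mul_le_mul_right _ (card_sumBox_le hs)
  have hG : ∀ p, (G p).card ≤ (m + 1) ^ (2 * s - 3) := by
    intro p
    by_cases hp : p.1 = p.2
    · simp [G, hp]
    · have : G p ⊆ ((sumBox s m c).filter fun u => u p.1 = u p.2) ×ˢ sumBox s m d := by
        intro w hw
        simp only [G, Finset.mem_filter, Finset.mem_product] at hw ⊢
        exact ⟨⟨hw.1.1, hw.2.2⟩, hw.1.2⟩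
      refine (Finset.card_le_card this).trans ?_
      rw [Finset.card_product, ← hpow, mul_comm]
      exact Nat.mul_le_mul (card_sumBox_le hs) (card_sumBox_filter_eq_le hp)
  have hsub : (sumBox s m c ×ˢ sumBox s m d).filter Coincide ⊆
      Finset.univ.biUnion F ∪ Finset.univ.biUnion G := by
    intro w hw
    rw [Finset.mem_filter] at hw
    simp only [F, G, Finset.mem_union, Finset.mem_biUnion, Finset.mem_univ, true_and,
      Finset.mem_filter, hw.1, Prod.exists]
    exact hw.2
  refine (Finset.card_le_card hsub).trans ((Finset.card_union_le _ _).trans ?_)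
  have h1 := Finset.card_biUnion_le_card_mul Finset.univ F _ fun p _ => hF p
  have h2 := Finset.card_biUnion_le_card_mul Finset.univ G _ fun p _ => hG p
  have h3 : (Finset.univ : Finset (Fin s × Fin s)).card = s ^ 2 := by
    simp [Finset.card_univ, sq]
  rw [h3] at h1 h2
  calc _ ≤ s ^ 2 * (m + 1) ^ (2 * s - 3) + s ^ 2 * (m + 1) ^ (2 * s - 3) := add_le_add h1 h2
    _ = _ := by ring

/-- Pairs `(u, v)` with a coincidence such that `∑ u` and `∑ u + ∑ v` lie in given windows. -/
def windowPairs (s m a p b q : ℕ) : Finset ((Fin s → ℕ) × (Fin s → ℕ)) :=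
  ((Fintype.piFinset fun _ : Fin s => Finset.range (m + 1)) ×ˢ
    (Fintype.piFinset fun _ : Fin s => Finset.range (m + 1))).filter fun w =>
      Coincide w ∧ ∑ i, w.1 i ∈ Finset.Ico a (a + p) ∧
        ∑ i, w.1 i + ∑ i, w.2 i ∈ Finset.Ico b (b + q)

lemma card_windowPairs_le {s m a p b q : ℕ} (hs : 2 ≤ s) :
    (windowPairs s m a p b q).card ≤ p * q * (2 * s ^ 2 * (m + 1) ^ (2 * s - 3)) := by
  have hsub : windowPairs s m a p b q ⊆ (Finset.Ico a (a + p) ×ˢ Finset.Ico b (b + q)).biUnion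
      fun x => (sumBox s m x.1 ×ˢ sumBox s m (x.2 - x.1)).filter Coincide := by
    intro w hw
    simp only [windowPairs, Finset.mem_filter, Finset.mem_product, Fintype.mem_piFinset,
      Finset.mem_range, Nat.lt_succ_iff] at hw
    rw [Finset.mem_biUnion]
    refine ⟨(∑ i, w.1 i, ∑ i, w.1 i + ∑ i, w.2 i), Finset.mem_product.mpr hw.2.2, ?_⟩
    rw [Finset.mem_filter, Finset.mem_product, mem_sumBox, mem_sumBox]
    exact ⟨⟨⟨hw.1.1, rfl⟩, hw.1.2, by simp⟩, hw.2.1⟩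
  refine (Finset.card_le_card hsub).trans
    ((Finset.card_biUnion_le_card_mul _ _ _ fun x _ => card_coincide_le hs).trans ?_)
  simp

/-- Quadruples of vectors. -/
abbrev Quad (s : ℕ) : Type := (Fin s → ℕ) × (Fin s → ℕ) × (Fin s → ℕ) × (Fin s → ℕ)

/-- The quadruples in `I_{m,s,k}` that pair up in every coordinate. -/
def pairedQuads (m s tm k : ℕ) : Finset (Quad s) :=
  (IndexSet m s tm k ×ˢ IndexSet m s tm k ×ˢ IndexSet m s tm k ×ˢ IndexSet m s tm k).filter
    fun A => ∀ i, PairsUp (A.1 i) (A.2.1 i) (A.2.2.1 i) (A.2.2.2 i)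

/-- The quadruple with first member `u` obtained by distributing a second vector `v` according to
the pairing pattern `π`. -/
def assemble {s : ℕ} (π : Fin s → Fin 3) (w : (Fin s → ℕ) × (Fin s → ℕ)) : Quad s :=
  (w.1, fun i => if π i = 0 then w.1 i else w.2 i, fun i => if π i = 1 then w.1 i else w.2 i,
    fun i => if π i = 2 then w.1 i else w.2 i)

lemma exists_pattern_of_pairsUp {a b c d : ℕ} (h : PairsUp a b c d) :
    ∃ (π : Fin 3) (v : ℕ), b = (if π = 0 then a else v) ∧ c = (if π = 1 then a else v) ∧
      d = (if π = 2 then a else v) := by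
  rcases h with ⟨h, h'⟩ | ⟨h, h'⟩ | ⟨h, h'⟩
  · exact ⟨0, c, by simp [h, h']⟩
  · exact ⟨1, b, by simp [h, h']⟩
  · exact ⟨2, b, by simp [h, h']⟩

/-- If the members of a paired quadruple have the same maximum, its two underlying vectors have
a coincidence. -/
lemma coincide_of_assemble {s k : ℕ} (hs : 2 ≤ s) (π : Fin s → Fin 3)
    (w : (Fin s → ℕ) × (Fin s → ℕ)) (h₁ : Finset.univ.sup (assemble π w).1 = k)
    (h₂ : Finset.univ.sup (assemble π w).2.1 = k) (h₃ : Finset.univ.sup (assemble π w).2.2.1 = k) :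
    Coincide w := by
  have : Nonempty (Fin s) := ⟨⟨0, by omega⟩⟩
  have hatt : ∀ f : Fin s → ℕ, Finset.univ.sup f = k → ∃ i, f i = k := fun f hf => by
    obtain ⟨i, -, hi⟩ := Finset.exists_mem_eq_sup Finset.univ Finset.univ_nonempty f
    exact ⟨i, hi.symm.trans hf⟩
  obtain ⟨i, hi⟩ := hatt _ h₁
  obtain ⟨i₂, hi₂⟩ := hatt _ h₂
  obtain ⟨i₃, hi₃⟩ := hatt _ h₃
  simp only [assemble] at hi hi₂ hi₃
  by_contra hc
  simp only [Coincide, not_or, not_exists, not_and] at hc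
  obtain ⟨hc₁, hc₂⟩ := hc
  split_ifs at hi₂ with hπ₂
  · split_ifs at hi₃ with hπ₃
    · have e₂ : i = i₂ := by_contra fun h => hc₂ i i₂ h (hi.trans hi₂.symm)
      have e₃ : i = i₃ := by_contra fun h => hc₂ i i₃ h (hi.trans hi₃.symm)
      rw [← e₂] at hπ₂
      rw [← e₃, hπ₂] at hπ₃
      exact absurd hπ₃ (by decide)
    · exact hc₁ i i₃ (hi.trans hi₃.symm)
  · exact hc₁ i i₂ (hi.trans hi₂.symm)

lemma sum_assemble {s : ℕ} (π : Fin s → Fin 3) (w : (Fin s → ℕ) × (Fin s → ℕ)) :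
    a0F (assemble π w).1 + a0F (assemble π w).2.1 + a0F (assemble π w).2.2.1 +
      a0F (assemble π w).2.2.2 = 2 * (∑ i, w.1 i + ∑ i, w.2 i) := by
  unfold a0F
  rw [← Finset.sum_add_distrib, ← Finset.sum_add_distrib, ← Finset.sum_add_distrib,
    ← Finset.sum_add_distrib, Finset.mul_sum]
  refine Finset.sum_congr rfl fun i _ => ?_
  have : π i = 0 ∨ π i = 1 ∨ π i = 2 := by
    generalize π i = x
    revert x
    decide
  rcases this with h | h | h <;> simp [assemble, h] <;> ring

lemma mem_IndexSet {m s tm k : ℕ} {A : Fin s → ℕ} (h : A ∈ IndexSet m s tm k) :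
    (∀ i, A i ≤ m) ∧ Finset.univ.sup A = k ∧ m < a0F A + tm ∧ a0F A < m + ⌈V0 m⌉₊ := by
  simp only [IndexSet, Finset.mem_filter, Fintype.mem_piFinset, Finset.mem_range,
    Nat.lt_succ_iff] at h
  obtain ⟨h1, h2, h3, h4⟩ := h
  refine ⟨h1, h2, ?_, ?_⟩
  · have : (m : ℝ) < (a0F A : ℝ) + tm := by linarith
    exact_mod_cast this
  · have : (a0F A : ℝ) < m + ⌈V0 m⌉₊ := h4.trans_le (by gcongr; exact Nat.le_ceil _)
    exact_mod_cast this

/-- The number of paired quadruples, over all `k`, is `≪ (t + log m)² m^{2s-3}`. -/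
lemma sum_card_pairedQuads_le {m s tm : ℕ} (hs : 2 ≤ s) (htm : tm ≤ m) :
    ∑ k ∈ Finset.Icc 1 m, (pairedQuads m s tm k).card ≤
      3 ^ s * ((tm + ⌈V0 m⌉₊) * (2 * (tm + ⌈V0 m⌉₊)) * (2 * s ^ 2 * (m + 1) ^ (2 * s - 3))) := by
  set L := ⌈V0 m⌉₊ with hL
  let W := windowPairs s m (m - tm) (tm + L) (2 * (m - tm)) (2 * (tm + L))
  rw [← Finset.card_biUnion]
  · have hsub : (Finset.Icc 1 m).biUnion (pairedQuads m s tm) ⊆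
        ((Finset.univ : Finset (Fin s → Fin 3)) ×ˢ W).image fun x => assemble x.1 x.2 := by
      rintro ⟨A₁, A₂, A₃, A₄⟩ hA
      obtain ⟨k, -, hA⟩ := Finset.mem_biUnion.mp hA
      simp only [pairedQuads, Finset.mem_filter, Finset.mem_product] at hA
      obtain ⟨⟨m₁, m₂, m₃, m₄⟩, hp⟩ := hA
      choose π v hv₂ hv₃ hv₄ using fun i => exists_pattern_of_pairsUp (hp i)
      have hasm : assemble π (A₁, v) = (A₁, A₂, A₃, A₄) := by
        simp only [assemble, Prod.mk.injEq, true_and]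
        exact ⟨funext fun i => (hv₂ i).symm, funext fun i => (hv₃ i).symm,
          funext fun i => (hv₄ i).symm⟩
      obtain ⟨b₁, s₁, l₁, u₁⟩ := mem_IndexSet m₁
      obtain ⟨b₂, s₂, l₂, u₂⟩ := mem_IndexSet m₂
      obtain ⟨b₃, s₃, l₃, u₃⟩ := mem_IndexSet m₃
      obtain ⟨b₄, s₄, l₄, u₄⟩ := mem_IndexSet m₄
      rw [Finset.mem_image]
      refine ⟨(π, (A₁, v)), Finset.mem_product.mpr ⟨Finset.mem_univ _, ?_⟩, hasm⟩
      have hco : Coincide (A₁, v) := by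
        apply coincide_of_assemble (k := k) hs π <;> rw [hasm] <;> assumption
      have hsum := sum_assemble π (A₁, v)
      rw [hasm] at hsum
      have hvm : ∀ i, v i ≤ m := fun i => by
        have h2 := hv₂ i
        have h3 := hv₃ i
        have := b₂ i
        have := b₃ i
        split_ifs at h2 h3 with h h'
        · rw [h] at h'
          exact absurd h' (by decide)
        all_goals omega
      simp only [W, windowPairs, Finset.mem_filter, Finset.mem_product, Fintype.mem_piFinset,
        Finset.mem_range, Nat.lt_succ_iff, Finset.mem_Ico]
      simp only at hsum
      have ha : a0F A₁ = ∑ i, A₁ i := rfl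
      exact ⟨⟨b₁, hvm⟩, hco, by omega, by omega⟩
    refine (Finset.card_le_card hsub).trans (Finset.card_image_le.trans ?_)
    rw [Finset.card_product]
    have h3 : (Finset.univ : Finset (Fin s → Fin 3)).card = 3 ^ s := by simp
    rw [h3]
    exact Nat.mul_le_mul_left _ (card_windowPairs_le hs)
  · intro k _ k' _ hkk
    rw [Function.onFun, Finset.disjoint_left]
    intro A hA hA'
    simp only [pairedQuads, Finset.mem_filter, Finset.mem_product] at hA hA'
    exact hkk ((mem_IndexSet hA.1.1).2.1.symm.trans (mem_IndexSet hA'.1.1).2.1)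

lemma Em_sum {m s : ℕ} {ι : Type*} (S : Finset ι)
    (f : ι → (Fin s → Fin m → Fin 2) → (Fin s → Fin m → Fin 2) → ℝ) :
    (Em m s fun x y => ∑ a ∈ S, f a x y) = ∑ a ∈ S, Em m s (f a) := by
  unfold Em
  rw [← Finset.mul_sum, Finset.sum_comm' (t' := Finset.univ) (s' := fun _ => S) (by simp)]
  congr 1
  exact Finset.sum_congr rfl fun x _ => Finset.sum_comm

lemma Em_le {m s : ℕ} {f : (Fin s → Fin m → Fin 2) → (Fin s → Fin m → Fin 2) → ℝ} {B : ℝ}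
    (hf : ∀ x y, f x y ≤ B) : Em m s f ≤ B := by
  unfold Em
  have h : ∑ x : Fin s → Fin m → Fin 2, ∑ y : Fin s → Fin m → Fin 2, f x y ≤
      (2 : ℝ) ^ (2 * s * m : ℤ) * B := by
    refine (Finset.sum_le_sum fun x _ => Finset.sum_le_sum fun y _ => hf x y).trans (le_of_eq ?_)
    have e : (2 * s * m : ℤ) = ((2 * s * m : ℕ) : ℤ) := by push_cast; ring
    rw [e, zpow_natCast]
    simp only [Finset.sum_const, Finset.card_univ, Fintype.card_pi, Fintype.card_fin,
      Finset.prod_const, nsmul_eq_mul]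
    push_cast
    ring
  calc _ ≤ (2 : ℝ) ^ (-(2 * s * m : ℤ)) * ((2 : ℝ) ^ (2 * s * m : ℤ) * B) := by gcongr
    _ = B := by rw [← mul_assoc, ← zpow_add₀ (by norm_num)]; simp

lemma sum_pow_four {ι : Type*} (S : Finset ι) (f : ι → ℝ) :
    (∑ a ∈ S, f a) ^ 4 =
      ∑ A ∈ S ×ˢ S ×ˢ S ×ˢ S, f A.1 * f A.2.1 * f A.2.2.1 * f A.2.2.2 := by
  simp only [Finset.sum_product, ← Finset.mul_sum, ← Finset.sum_mul]
  ring

/-- The fourth moment of `𝔇_k` is controlled by the number of paired quadruples. -/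
lemma Em_DDk_pow_four_le {m s tm : ℕ} {C : Fin s → Matrix (Fin m) (Fin m) (ZMod 2)}
    (hnet : IsNet tm m s (fun n : Fin (2 ^ m) => netPoint m s C (n : ℕ))) (htm : tm ≤ m)
    (k : ℕ) :
    (Em m s fun x y => DDk m s tm C k x y ^ 4) ≤ (pairedQuads m s tm k).card * (2 ^ tm) ^ 4 := by
  simp only [DDk, sum_pow_four]
  rw [Em_sum, ← nsmul_eq_mul, pairedQuads, ← Finset.sum_filter_of_ne
    (p := fun A : Quad s => ∀ i, PairsUp (A.1 i) (A.2.1 i) (A.2.2.1 i) (A.2.2.2 i))]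
  · refine Finset.sum_le_card_nsmul _ _ _ fun A hA => Em_le fun x y => ?_
    simp only [Finset.mem_filter, Finset.mem_product] at hA
    obtain ⟨⟨h₁, h₂, h₃, h₄⟩, -⟩ := hA
    have hb : ∀ A ∈ IndexSet m s tm k, |PsiF m s C A x y| ≤ 2 ^ tm := fun A hA =>
      abs_PsiF_le hnet htm A (mem_IndexSet hA).1 (mem_IndexSet hA).2.2.1.le x y
    refine (le_abs_self _).trans ?_
    rw [abs_mul, abs_mul, abs_mul, show ((2 : ℝ) ^ tm) ^ 4 = 2 ^ tm * 2 ^ tm * 2 ^ tm * 2 ^ tm by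
      ring]
    gcongr <;> exact hb _ (by assumption)
  · intro A hA hne
    simp only [Finset.mem_product] at hA
    by_contra hp
    exact hne (Em_PsiF_mul_eq_zero C _ _ _ _ (mem_IndexSet hA.1).1 (mem_IndexSet hA.2.1).1
      (mem_IndexSet hA.2.2.1).1 (mem_IndexSet hA.2.2.2).1 hp)

lemma logb_two_le {x : ℝ} (hx : 1 ≤ x) : Real.logb 2 x ≤ 20 * x ^ (1 / 10 : ℝ) := by
  have h1 : Real.log x ≤ x ^ (1 / 10 : ℝ) / (1 / 10) :=
    Real.log_le_rpow_div (by linarith) (by norm_num)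
  have h2 : (1 / 2 : ℝ) ≤ Real.log 2 := by linarith [Real.log_two_gt_d9]
  have h3 : (0 : ℝ) ≤ x ^ (1 / 10 : ℝ) := by positivity
  rw [Real.logb, div_le_iff₀ (by linarith)]
  nlinarith

/-- Lemma 3: fourth moment estimate
`∑_{k=1}^m E^{(m)}_{Y,T}(𝔇_k⁴) ≪ m^{2(s-1)-2/5}`, with the implied constant
depending only on `s`. -/
theorem statement10 (s : ℕ) (hs : 2 ≤ s) :
    ∃ c : ℝ, 0 < c ∧ ∀ (m tm : ℕ), 1 ≤ m →
      ∀ C : Fin s → Matrix (Fin m) (Fin m) (ZMod 2),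
        IsNet tm m s (fun n : Fin (2 ^ m) => netPoint m s C (n : ℕ)) →
        (tm : ℝ) ≤ Real.logb 2 m / 10 →
        (∑ k ∈ Finset.Icc 1 m, Em m s fun t y => DDk m s tm C k t y ^ 4) ≤
          c * (m : ℝ) ^ (2 * ((s : ℝ) - 1) - 2 / 5) := by
  refine ⟨3 ^ s * (300 * (2 * 300)) * (2 * s ^ 2 * 2 ^ (2 * s - 3)), by positivity, ?_⟩
  intro m tm hm C hnet htm
  have hm1 : (1 : ℝ) ≤ m := by exact_mod_cast hm
  have hm0 : (0 : ℝ) < m := by linarith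
  set r : ℝ := (m : ℝ) ^ (1 / 10 : ℝ) with hr
  have hr1 : 1 ≤ r := Real.one_le_rpow hm1 (by norm_num)
  have h2t : (2 : ℝ) ^ tm ≤ r := by
    have h : (2 : ℝ) ^ (tm : ℝ) ≤ (2 : ℝ) ^ (Real.logb 2 m * (1 / 10)) :=
      Real.rpow_le_rpow_of_exponent_le (by norm_num) (by linarith)
    rwa [Real.rpow_natCast, Real.rpow_mul (by norm_num),
      Real.rpow_logb (by norm_num) (by norm_num) hm0] at h
  have hrm : r ≤ m := by
    simpa only [Real.rpow_one] using
      Real.rpow_le_rpow_of_exponent_le hm1 (by norm_num : (1 / 10 : ℝ) ≤ 1)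
  have htmm : tm ≤ m := by
    have h : 2 ^ tm ≤ m := by exact_mod_cast h2t.trans hrm
    exact (Nat.lt_two_pow_self.trans_le h).le
  have hlog := logb_two_le hm1
  have hlog0 : 0 ≤ Real.logb 2 m := Real.logb_nonneg (by norm_num) hm1
  have hL : ((tm + ⌈V0 m⌉₊ : ℕ) : ℝ) ≤ 300 * r := by
    have := (Nat.ceil_lt_add_one (by unfold V0; positivity : 0 ≤ V0 m)).le
    unfold V0 at this
    push_cast [V0]
    linarith
  have hcard : (∑ k ∈ Finset.Icc 1 m, ((pairedQuads m s tm k).card : ℝ)) ≤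
      3 ^ s * ((tm + ⌈V0 m⌉₊ : ℕ) * (2 * (tm + ⌈V0 m⌉₊ : ℕ)) *
        (2 * s ^ 2 * ((m : ℝ) + 1) ^ (2 * s - 3))) := by
    exact_mod_cast sum_card_pairedQuads_le hs htmm
  have hexp : r ^ 6 * (m : ℝ) ^ (2 * s - 3) = (m : ℝ) ^ (2 * ((s : ℝ) - 1) - 2 / 5) := by
    rw [hr, ← Real.rpow_natCast, ← Real.rpow_mul hm0.le, ← Real.rpow_natCast (m : ℝ),
      ← Real.rpow_add hm0, Nat.cast_sub (by omega)]
    congr 1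
    push_cast
    ring
  calc (∑ k ∈ Finset.Icc 1 m, Em m s fun t y => DDk m s tm C k t y ^ 4)
      ≤ ∑ k ∈ Finset.Icc 1 m, ((pairedQuads m s tm k).card : ℝ) * (2 ^ tm) ^ 4 :=
        Finset.sum_le_sum fun k _ => Em_DDk_pow_four_le hnet htmm k
    _ = (∑ k ∈ Finset.Icc 1 m, ((pairedQuads m s tm k).card : ℝ)) * (2 ^ tm) ^ 4 := by
        rw [Finset.sum_mul]
    _ ≤ (3 ^ s * ((300 * r) * (2 * (300 * r)) * (2 * s ^ 2 * ((m : ℝ) + m) ^ (2 * s - 3)))) *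
          r ^ 4 := by
        gcongr
        refine hcard.trans ?_
        gcongr
    _ = 3 ^ s * (300 * (2 * 300)) * (2 * s ^ 2 * 2 ^ (2 * s - 3)) *
          (r ^ 6 * (m : ℝ) ^ (2 * s - 3)) := by
        rw [← two_mul (m : ℝ), mul_pow]
        ring
    _ = _ := by rw [hexp]
end
end
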